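/- Let G be an amenable group and let X be an irreducible complete algebraic variety over an algebraically closed field K. Let A := X(K) and let τ : A^G → A^G be an algebraic cellular automaton over (G,X,K). Then the following conditions are equivalent: (a) τ is surjective; (b) τ is (*)-pre-injective; (c) τ is (**)-pre-injective; (d) for some (equivalently, any) Følner net F of G, one has mdim_F(τ(A^G)) = dim(X). Moreover, if τ is pre-injective then it is surjective. -/

import Mathlib

open AlgebraicGeometry CategoryTheory CategoryTheory.Limits Filter Topology
open scoped ENNReal NNReal

noncomputable section

namespace GOE

/-! ## Følner nets and amenability -/

/-- A (right) Følner net for a group `G`: a net of nonempty finite subsets `F i ⊆ G`,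
indexed by a directed nonempty preorder, such that `|F i \ F i g| / |F i| → 0` for every
`g ∈ G`. -/
structure FolnerNet (G : Type) [Group G] where
  ι : Type
  [pre : Preorder ι]
  [ne : Nonempty ι]
  [dir : IsDirected ι (· ≤ ·)]
  F : ι → Finset G
  nonempty : ∀ i, (F i).Nonempty
  folner : ∀ g : G,
    Filter.Tendsto
      (fun i => ((((F i : Set G) \ ((· * g) '' (F i : Set G))).ncard : ℝ) / ((F i).card : ℝ)))
      Filter.atTop (nhds 0)

attribute [instance] FolnerNet.pre FolnerNet.ne FolnerNet.dir

/-- A group is amenable if it admits a Følner net. -/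
def Amenable (G : Type) [Group G] : Prop := Nonempty (FolnerNet G)

/-! ## Constructible subsets of a topological space -/

/-- A subset of a topological space is constructible if it is a finite union of
locally closed subsets. -/
def IsConstr {X : Type} [TopologicalSpace X] (C : Set X) : Prop :=
  ∃ (n : ℕ) (U Z : Fin n → Set X), (∀ i, IsOpen (U i)) ∧ (∀ i, IsClosed (Z i)) ∧
    C = ⋃ i, U i ∩ Z i

/-- Conversion of a Krull dimension (an element of `WithBot ℕ∞`) to an extended real. -/
def dimE (d : WithBot ℕ∞) : EReal :=
  WithBot.recBotCoe ⊥ (fun n : ℕ∞ => ((n : ℝ≥0∞) : EReal)) d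

/-! ## Varieties over a field and their points -/

variable (K : Type) [Field K]

/-- The spectrum of the field `K`, as a scheme. -/
abbrev SpecK : Scheme := Spec (CommRingCat.of K)

/-- The unique point of `Spec K`. -/
def specPt : SpecK K := (⟨⊥, Ideal.bot_prime⟩ : PrimeSpectrum K)

instance : HasFiniteProducts (Over (SpecK K)) :=
  CategoryTheory.Over.ConstructProducts.over_finiteProducts_of_finiteWidePullbacks

/-- The set of `K`-points of a `K`-scheme, i.e. sections of the structure morphism,
i.e. morphisms `Spec K ⟶ X` over `Spec K`. -/
abbrev Pt (W : Over (SpecK K)) : Type := Over.mk (𝟙 (SpecK K)) ⟶ W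

/-- The image in (the underlying space of) `W` of a `K`-point of `W`. -/
def ev {W : Over (SpecK K)} (a : Pt K W) : W.left := a.left.base (specPt K)

/-- The fibered power `X^Ω` over `Spec K` of a `K`-scheme `X`, for a finite index set `Ω`. -/
def pow (V : Over (SpecK K)) (Ω : Type) [Finite Ω] : Over (SpecK K) :=
  ∏ᶜ (fun _ : Ω => V)

/-- The canonical identification of families of `K`-points indexed by `Ω` with
`K`-points of the fibered power `X^Ω`. -/
def ptPow (V : Over (SpecK K)) (Ω : Type) [Finite Ω] (a : Ω → Pt K V) :
    Pt K (pow K V Ω) := Pi.lift a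

variable (V : Over (SpecK K))

/-- The Krull dimension of (the underlying space of) a `K`-scheme. -/
def vdim : WithBot ℕ∞ := topologicalKrullDim V.left

/-- The Zariski topology on `A^Ω` (`A` the set of `K`-points of `X`), induced from the
Zariski topology of the fibered power `X^Ω` via the identification of `A^Ω` with a
subset (the set of closed points, for `K` algebraically closed) of `X^Ω`. -/
def cfgTop (Ω : Type) [Finite Ω] : TopologicalSpace (Ω → Pt K V) :=
  TopologicalSpace.induced (fun u => ev K (ptPow K V Ω u)) inferInstance

/-- The Krull dimension of a subset `D ⊆ A^Ω` for the Zariski topology. -/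
def cfgDim (Ω : Type) [Finite Ω] (D : Set (Ω → Pt K V)) : WithBot ℕ∞ :=
  letI := cfgTop K V Ω
  topologicalKrullDim D

/-- `D ⊆ A^Ω` is closed for the Zariski topology. -/
def cfgClosed (Ω : Type) [Finite Ω] (D : Set (Ω → Pt K V)) : Prop :=
  letI := cfgTop K V Ω
  IsClosed D

/-- `D ⊆ A^Ω` is constructible for the Zariski topology. -/
def cfgConstr (Ω : Type) [Finite Ω] (D : Set (Ω → Pt K V)) : Prop :=
  letI := cfgTop K V Ω
  IsConstr D

/-! ## Configurations, restrictions, cylinders -/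

variable {G : Type} [Group G]

/-- The restriction `Γ_Ω ⊆ A^Ω` of a set of configurations `Γ ⊆ A^G`. -/
def restr (Γ : Set (G → Pt K V)) (Ω : Finset G) : Set (↥Ω → Pt K V) :=
  (fun c (ω : ↥Ω) => c ω) '' Γ

/-- The cylinder `D_p ⊆ A^G`: configurations restricting to an element of `D` on `Ω` and
to `p` on `G ∖ Ω`. -/
def cyl (Ω : Finset G) (D : Set (↥Ω → Pt K V)) (p : {g : G // g ∉ Ω} → Pt K V) :
    Set (G → Pt K V) :=
  {c | (fun ω : ↥Ω => c ω) ∈ D ∧ ∀ (g : G) (h : g ∉ Ω), c g = p ⟨g, h⟩}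

/-- Algebraic mean dimension of `Γ ⊆ A^G` with respect to a Følner net. -/
def mdim (𝓕 : FolnerNet G) (Γ : Set (G → Pt K V)) : EReal :=
  Filter.limsup
    (fun i => dimE (cfgDim K V ↥(𝓕.F i) (restr K V Γ (𝓕.F i))) *
      ((((𝓕.F i).card : ℝ)⁻¹ : ℝ) : EReal))
    Filter.atTop

/-! ## Cellular automata -/

/-- `τ : A^G → A^G` is an algebraic cellular automaton over `(G, X, K)`: it admits a finite
memory set `M ⊆ G` whose associated local defining map `A^M → A` is induced by a morphism
of `K`-schemes `f : X^M → X`. -/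
def IsAlgCA (τ : (G → Pt K V) → (G → Pt K V)) : Prop :=
  ∃ (M : Finset G) (f : pow K V ↥M ⟶ V),
    ∀ (x : G → Pt K V) (g : G),
      τ x g = ptPow K V ↥M (fun m => x (g * (m : G))) ≫ f

/-- Pre-injectivity: configurations that are almost equal and have the same image are equal. -/
def PreInjective (τ : (G → Pt K V) → (G → Pt K V)) : Prop :=
  ∀ c₁ c₂ : G → Pt K V, {g : G | c₁ g ≠ c₂ g}.Finite → τ c₁ = τ c₂ → c₁ = c₂

/-- `(*)`-pre-injectivity: there exist no finite subset `Ω ⊆ G` and Zariski-closed proper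
subset `H ⊊ A^Ω` such that `τ((A^Ω)_p) = τ(H_p)` for all `p ∈ A^{G∖Ω}`. -/
def StarPreInjective (τ : (G → Pt K V) → (G → Pt K V)) : Prop :=
  ¬ ∃ (Ω : Finset G) (H : Set (↥Ω → Pt K V)), cfgClosed K V ↥Ω H ∧ H ≠ Set.univ ∧
      ∀ p : {g : G // g ∉ Ω} → Pt K V,
        τ '' cyl K V Ω Set.univ p = τ '' cyl K V Ω H p

/-- `(**)`-pre-injectivity: there is no finite subset `Ω ⊆ G` such that, for every
`p ∈ A^{G∖Ω}`, the finite-support set `τ((A^Ω)_p)` (written as some `R_s`) satisfies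
`dim(R) < dim(A^Ω)`. -/
def StarStarPreInjective (τ : (G → Pt K V) → (G → Pt K V)) : Prop :=
  ¬ ∃ Ω : Finset G, ∀ p : {g : G // g ∉ Ω} → Pt K V,
      ∃ (Λ : Finset G) (R : Set (↥Λ → Pt K V)) (s : {g : G // g ∉ Λ} → Pt K V),
        τ '' cyl K V Ω Set.univ p = cyl K V Λ R s ∧
        cfgDim K V ↥Λ R < cfgDim K V ↥Ω (Set.univ : Set (↥Ω → Pt K V))

/-- `Γ ⊆ A^G` is closed for the prodiscrete topology on `A^G`. -/
def ProdiscreteClosed {A : Type} (Γ : Set (G → A)) : Prop :=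
  letI : TopologicalSpace A := ⊥
  IsClosed Γ

/-- `Γ ⊆ A^G` is invariant under the shift action of `G`. -/
def ShiftInvariant {A : Type} (Γ : Set (G → A)) : Prop :=
  ∀ (g : G), ∀ c ∈ Γ, (fun h : G => c (g⁻¹ * h)) ∈ Γ

/-- An `(E,E')`-tiling of `G`. -/
def IsTiling (E E' : Finset G) (T : Set G) : Prop :=
  (∀ g ∈ T, ∀ h ∈ T, g ≠ h →
    Disjoint ((g * ·) '' (E : Set G)) ((h * ·) '' (E : Set G))) ∧
  ∀ x : G, ∃ g ∈ T, x ∈ (g * ·) '' (E' : Set G)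


/-! ## Topological preliminaries -/

open TopologicalSpace in
lemma nat_le_krullDim_iff_exists_height {α : Type*} [Preorder α] {n : ℕ} :
    (n : WithBot ℕ∞) ≤ Order.krullDim α ↔ ∃ a : α, (n : ℕ∞) ≤ Order.height a := by
  rw [Order.le_krullDim_iff]
  constructor
  · rintro ⟨l, rfl⟩
    exact ⟨l.last, Order.length_le_height_last⟩
  · rintro ⟨a, ha⟩
    obtain ⟨p, -, hp⟩ := Order.exists_series_of_le_height a ha
    exact ⟨p, hp⟩

lemma krullDim_le_of_forall_nat {α : Type*} [Preorder α] {d : WithBot ℕ∞}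
    (h : ∀ n : ℕ, (n : WithBot ℕ∞) ≤ Order.krullDim α → (n : WithBot ℕ∞) ≤ d) :
    Order.krullDim α ≤ d := by
  refine iSup_le fun l => h _ ?_
  exact Order.LTSeries.length_le_krullDim l

lemma exists_lt_of_succ_le_height {α : Type*} [Preorder α] {n : ℕ} {a : α}
    (h : ((n + 1 : ℕ) : ℕ∞) ≤ Order.height a) : ∃ b < a, (n : ℕ∞) ≤ Order.height b := by
  by_contra! H
  have := (Order.height_le_coe_iff (n := n)).2 H
  have := h.trans this
  norm_cast at this
  omega

/-- The image of a product of irreducible sets under a separately continuous map is irreducible. -/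
lemma isIrreducible_image2 {X Y Z : Type*} [TopologicalSpace X] [TopologicalSpace Y]
    [TopologicalSpace Z] {m : X → Y → Z} (h₁ : ∀ y, Continuous fun x => m x y)
    (h₂ : ∀ x, Continuous (m x)) {C : Set X} {D : Set Y} (hC : IsIrreducible C)
    (hD : IsIrreducible D) : IsIrreducible (Set.image2 m C D) := by
  refine ⟨hC.1.image2 hD.1, ?_⟩
  rintro u v hu hv ⟨_, ⟨x₁, hx₁, y₁, hy₁, rfl⟩, h₁u⟩ ⟨_, ⟨x₂, hx₂, y₂, hy₂, rfl⟩, h₂v⟩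
  obtain ⟨x, hxC, hxu, hxv⟩ := hC.2 _ _ (hu.preimage (h₁ y₁)) (hv.preimage (h₁ y₂))
    ⟨x₁, hx₁, h₁u⟩ ⟨x₂, hx₂, h₂v⟩
  obtain ⟨y, hyD, hyu, hyv⟩ := hD.2 _ _ (hu.preimage (h₂ x)) (hv.preimage (h₂ x))
    ⟨y₁, hy₁, hxu⟩ ⟨y₂, hy₂, hxv⟩
  exact ⟨m x y, ⟨x, hxC, y, hyD, rfl⟩, hyu, hyv⟩

section

variable {X Y : Type*} [TopologicalSpace X] [TopologicalSpace Y]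

open TopologicalSpace

lemma exists_irreducible_image_eq [NoetherianSpace X] {f : X → Y} (hf : Continuous f)
    (hfc : IsClosedMap f) {S : Set X} (hS : IsClosed S) {D : Set Y} (hD : IsIrreducible D)
    (hDc : IsClosed D) (hDS : D ⊆ f '' S) :
    ∃ C : IrreducibleCloseds X, (C : Set X) ⊆ S ∧ f '' (C : Set X) = D := by
  obtain ⟨F, hF, hFc, hFi, hFS⟩ := NoetherianSpace.exists_finite_set_isClosed_irreducible
    (hS.inter (hDc.preimage hf))
  have hcov : D ⊆ ⋃₀ (Set.image f '' F) := by
    intro y hy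
    obtain ⟨x, hx, rfl⟩ := hDS hy
    have : x ∈ ⋃₀ F := hFS ▸ ⟨hx, hy⟩
    obtain ⟨t, ht, hxt⟩ := this
    exact ⟨f '' t, ⟨t, ht, rfl⟩, x, hxt, rfl⟩
  obtain ⟨_, ht, hDt⟩ := (isIrreducible_iff_sUnion_isClosed.1 hD) (hF.image (Set.image f)).toFinset
    (by
      intro z hz
      obtain ⟨t, ht, rfl⟩ := by simpa using hz
      exact hfc _ (hFc t ht)) (by simpa using hcov)
  obtain ⟨t, htF, rfl⟩ := (hF.image (Set.image f)).mem_toFinset.1 ht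
  have hsub : t ⊆ S ∩ f ⁻¹' D := hFS ▸ Set.subset_sUnion_of_mem htF
  exact ⟨⟨t, hFi t htF, hFc t htF⟩, fun x hx => (hsub hx).1,
    (Set.image_subset_iff.2 fun x hx => (hsub hx).2).antisymm hDt⟩

lemma height_le_height_of_image_eq [NoetherianSpace X] {f : X → Y} (hf : Continuous f)
    (hfc : IsClosedMap f) (n : ℕ) : ∀ (C : IrreducibleCloseds X) (D : IrreducibleCloseds Y),
      f '' (C : Set X) = D → (n : ℕ∞) ≤ Order.height D → (n : ℕ∞) ≤ Order.height C := by
  induction n with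
  | zero => simp
  | succ n ih =>
    intro C D hCD hn
    obtain ⟨D', hD', hn'⟩ := exists_lt_of_succ_le_height hn
    obtain ⟨C', hC', hCD'⟩ := exists_irreducible_image_eq hf hfc C.isClosed D'.isIrreducible
      D'.isClosed (hCD ▸ hD'.le)
    have hlt : C' < C := by
      refine lt_of_le_of_ne hC' ?_
      rintro rfl
      exact hD'.ne (SetLike.coe_injective (hCD'.symm.trans hCD))
    calc ((n + 1 : ℕ) : ℕ∞) ≤ Order.height C' + 1 := by
          push_cast; gcongr; exact ih C' D' hCD' hn'
      _ ≤ _ := Order.height_add_one_le hlt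

/-- A continuous closed surjection out of a Noetherian space does not increase the dimension. -/
lemma topologicalKrullDim_le_of_closed_surjective [NoetherianSpace X] {f : X → Y}
    (hf : Continuous f) (hfc : IsClosedMap f) (hs : Function.Surjective f) :
    topologicalKrullDim Y ≤ topologicalKrullDim X := by
  refine krullDim_le_of_forall_nat fun n hn => ?_
  obtain ⟨D, hD⟩ := nat_le_krullDim_iff_exists_height.1 hn
  obtain ⟨C, -, hC⟩ := exists_irreducible_image_eq hf hfc isClosed_univ D.isIrreducible
    D.isClosed (by rw [Set.image_univ, hs.range_eq]; exact Set.subset_univ _)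
  exact nat_le_krullDim_iff_exists_height.2 ⟨C, height_le_height_of_image_eq hf hfc n C D hC hD⟩

lemma topologicalKrullDim_image_le [NoetherianSpace X] {f : X → Y}
    (hf : Continuous f) (hfc : IsClosedMap f) {S : Set X} (hS : IsClosed S) :
    topologicalKrullDim (f '' S) ≤ topologicalKrullDim S := by
  have hN : NoetherianSpace S := IsInducing.subtypeVal.noetherianSpace
  refine topologicalKrullDim_le_of_closed_surjective (f := fun x : S => (⟨f x, x, x.2, rfl⟩ : f '' S))
    (by fun_prop) ?_ ?_
  · intro t ht
    refine ⟨(f '' ((↑) '' t))ᶜ, (hfc _ (hS.isClosedMap_subtype_val t ht)).isOpen_compl, ?_⟩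
    ext ⟨y, hy⟩
    simp [Subtype.ext_iff]
  · rintro ⟨_, x, hx, rfl⟩
    exact ⟨⟨x, hx⟩, rfl⟩

lemma topologicalKrullDim_mono {S T : Set X} (h : S ⊆ T) :
    topologicalKrullDim S ≤ topologicalKrullDim T :=
  (IsEmbedding.inclusion h).isInducing.topologicalKrullDim_le

/-- A continuous map whose fibres have no nontrivial specializations does not decrease the
dimension. -/
lemma topologicalKrullDim_le_range [QuasiSober X] [T0Space Y] {f : X → Y} (hf : Continuous f)
    (h : ∀ x y, x ⤳ y → f x = f y → x = y) :
    topologicalKrullDim X ≤ topologicalKrullDim (Set.range f) := by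
  let g : X → Set.range f := Set.rangeFactorization f
  have hg : Continuous g := by fun_prop
  refine Order.krullDim_le_of_strictMono (IrreducibleCloseds.map g hg) ?_
  intro C D hCD
  refine lt_of_le_of_ne (closure_mono (Set.image_mono hCD.le)) fun heq => hCD.ne ?_
  obtain ⟨x, hx⟩ := QuasiSober.sober C.isIrreducible C.isClosed
  obtain ⟨y, hy⟩ := QuasiSober.sober D.isIrreducible D.isClosed
  have e : closure (g '' (C : Set X)) = closure (g '' (D : Set X)) := congrArg SetLike.coe heq
  have e' : g x = g y := by
    have h1 := hx.image hg
    have h2 := hy.image hg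
    rw [e] at h1
    exact h1.eq h2
  have hyx : y ⤳ x := hy.specializes (hCD.le (hx.mem))
  have : y = x := h y x hyx (congrArg Subtype.val e'.symm)
  subst this
  exact SetLike.coe_injective (hx.def.symm.trans hy.def)

/-- Passing to the closed points of a Jacobson space does not change the dimension. -/
lemma topologicalKrullDim_eq_of_closedPoints [JacobsonSpace Y] {f : X → Y} (hf : IsInducing f)
    (h : closedPoints Y ⊆ Set.range f) : topologicalKrullDim X = topologicalKrullDim Y := by
  refine le_antisymm hf.topologicalKrullDim_le ?_
  have key : ∀ Z : Set Y, IsClosed Z → closure (f '' (f ⁻¹' Z)) = Z := by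
    intro Z hZ
    rw [Set.image_preimage_eq_inter_range]
    refine subset_antisymm (hZ.closure_subset_iff.2 Set.inter_subset_left) ?_
    conv_lhs => rw [← hZ.closure_eq,
      ← JacobsonSpace.closure_inter_closedPoints_eq_closure hZ.isLocallyClosed]
    exact closure_mono (Set.inter_subset_inter_right _ h)
  refine Order.krullDim_le_of_strictMono (fun Z => ⟨f ⁻¹' Z, ?_, Z.isClosed.preimage hf.continuous⟩)
    ?_
  · have := Z.isIrreducible
    rw [← key Z Z.isClosed, isIrreducible_iff_closure] at this
    refine ⟨this.1.of_image, ?_⟩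
    have h2 := this.2
    intro u v hu hv hu' hv'
    obtain ⟨u, hou, rfl⟩ := hf.isOpen_iff.1 hu
    obtain ⟨v, hov, rfl⟩ := hf.isOpen_iff.1 hv
    obtain ⟨x, hx, hxu⟩ := hu'
    obtain ⟨y, hy, hyv⟩ := hv'
    obtain ⟨_, ⟨z, hz, rfl⟩, hzu, hzv⟩ := h2 u v hou hov ⟨f x, ⟨x, hx, rfl⟩, hxu⟩
      ⟨f y, ⟨y, hy, rfl⟩, hyv⟩
    exact ⟨z, hz, hzu, hzv⟩
  · intro Z W hZW
    refine lt_of_le_of_ne (Set.preimage_mono (f := f) hZW.le) fun heq => hZW.ne ?_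
    have e : f ⁻¹' (Z : Set Y) = f ⁻¹' (W : Set Y) := congrArg SetLike.coe heq
    apply SetLike.coe_injective
    rw [← key Z Z.isClosed, e, key W W.isClosed]

/-- A bound for the dimension may be checked on open neighbourhoods of points. -/
lemma topologicalKrullDim_le_of_nhds {d : WithBot ℕ∞}
    (h : ∀ x : X, ∃ U : Set X, IsOpen U ∧ x ∈ U ∧ topologicalKrullDim U ≤ d) :
    topologicalKrullDim X ≤ d := by
  refine iSup_le fun l => ?_
  obtain ⟨x, hx⟩ := (l 0).isIrreducible.1
  obtain ⟨U, hU, hxU, hd⟩ := h x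
  refine le_trans ?_ hd
  have hne : ∀ i, ((l i : Set X) ∩ U).Nonempty := fun i =>
    ⟨x, l.monotone (Fin.zero_le i) hx, hxU⟩
  have key : ∀ i, closure ((↑) '' ((↑) ⁻¹' (l i : Set X) : Set U)) = (l i : Set X) := by
    intro i
    rw [Subtype.image_preimage_coe]
    refine subset_antisymm ((l i).isClosed.closure_subset_iff.2 Set.inter_subset_right) ?_
    have := subset_closure_inter_of_isPreirreducible_of_isOpen (l i).isIrreducible.2 hU (hne i)
    rwa [Set.inter_comm] at this
  let l' : LTSeries (IrreducibleCloseds U) :=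
    { length := l.length
      toFun := fun i => ⟨(↑) ⁻¹' (l i : Set X), by
          refine ⟨?_, (l i).isIrreducible.2.preimage hU.isOpenEmbedding_subtypeVal⟩
          obtain ⟨y, hy, hyU⟩ := hne i
          exact ⟨⟨y, hyU⟩, hy⟩, (l i).isClosed.preimage continuous_subtype_val⟩
      step := fun i => by
        have hlt : l i.castSucc < l i.succ := l.step i
        refine lt_of_le_of_ne (Set.preimage_mono hlt.le) fun heq => hlt.ne ?_
        apply SetLike.coe_injective
        rw [← key, heq, key] }
  exact Order.LTSeries.length_le_krullDim l'

end

theorem ringKrullDim_le_of_isIntegral {R S : Type} [CommRing R] [CommRing S] {f : R →+* S}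
    (hf : f.IsIntegral) : ringKrullDim S ≤ ringKrullDim R := by
  algebraize [f]
  refine Order.krullDim_le_of_strictMono (PrimeSpectrum.comap f) fun p q hpq => ?_
  exact Ideal.IsIntegral.comap_lt_comap (R := R) hpq

theorem ringKrullDim_le_of_isIntegral_of_injective {R S : Type} [CommRing R] [CommRing S]
    [IsNoetherianRing S] {f : R →+* S} (hf : f.IsIntegral) (hi : Function.Injective f) :
    ringKrullDim R ≤ ringKrullDim S := by
  rw [← PrimeSpectrum.topologicalKrullDim_eq_ringKrullDim,
    ← PrimeSpectrum.topologicalKrullDim_eq_ringKrullDim]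
  exact topologicalKrullDim_le_of_closed_surjective (PrimeSpectrum.continuous_comap f)
    (PrimeSpectrum.isClosedMap_comap_of_isIntegral f hf) (hf.comap_surjective hi)

theorem ringKrullDim_mvPolynomial_field (K : Type) [Field K] (σ : Type) [Finite σ] :
    ringKrullDim (MvPolynomial σ K) = Nat.card σ := by
  rw [MvPolynomial.ringKrullDim_of_isNoetherianRing, ringKrullDim_eq_zero_of_field, zero_add]

theorem ringKrullDim_eq_trdeg (K R : Type) [Field K] [CommRing R] [IsDomain R] [Algebra K R]
    [Algebra.FiniteType K R] : ∃ n : ℕ, ringKrullDim R = n ∧ Algebra.trdeg K R = n := by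
  obtain ⟨s, g, hi, hg⟩ := exists_integral_inj_algHom_of_fg K R
  have : IsNoetherianRing R := Algebra.FiniteType.isNoetherianRing K R
  refine ⟨s, ?_, ?_⟩
  · have := ringKrullDim_mvPolynomial_field K (Fin s)
    rw [Nat.card_eq_fintype_card, Fintype.card_fin] at this
    rw [← this]
    exact le_antisymm (ringKrullDim_le_of_isIntegral hg)
      (ringKrullDim_le_of_isIntegral_of_injective hg hi)
  · algebraize [g.toRingHom]
    have : IsScalarTower K (MvPolynomial (Fin s) K) R := IsScalarTower.of_algebraMap_eq' (by
      ext x; exact (g.commutes x).symm)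
    have : FaithfulSMul (MvPolynomial (Fin s) K) R :=
      (faithfulSMul_iff_algebraMap_injective _ _).2 hi
    have := _root_.trdeg_add_eq K (MvPolynomial (Fin s) K) (A := R)
    rw [← this, _root_.trdeg_eq_zero (R := MvPolynomial (Fin s) K), MvPolynomial.trdeg_of_isDomain]
    simp

theorem ringKrullDim_le_of_isLocalization_away {K R S : Type} [Field K] [CommRing R] [IsDomain R]
    [Algebra K R] [Algebra.FiniteType K R] [CommRing S] [Algebra R S] {f : R} (hf : f ≠ 0)
    [IsLocalization.Away f S] : ringKrullDim R ≤ ringKrullDim S := by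
  let := ((algebraMap R S).comp (algebraMap K R)).toAlgebra
  have : IsScalarTower K R S := IsScalarTower.of_algebraMap_eq' rfl
  have hle : Submonoid.powers f ≤ nonZeroDivisors R :=
    powers_le_nonZeroDivisors_of_noZeroDivisors hf
  have : IsDomain S := IsLocalization.isDomain_of_le_nonZeroDivisors S hle
  have hRS : Algebra.FiniteType R S :=
    IsLocalization.finiteType_of_monoid_fg (Submonoid.powers f) S
  have : Algebra.FiniteType K S := Algebra.FiniteType.trans (S := R) inferInstance hRS
  obtain ⟨n, hn, hn'⟩ := ringKrullDim_eq_trdeg K R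
  obtain ⟨m, hm, hm'⟩ := ringKrullDim_eq_trdeg K S
  have h : Algebra.trdeg K R ≤ Algebra.trdeg K S :=
    _root_.trdeg_le_of_injective (IsScalarTower.toAlgHom K R S) (IsLocalization.injective S hle)
  rw [hn', hm'] at h
  rw [hn, hm]
  exact_mod_cast h

theorem topologicalKrullDim_le_basicOpen {K R : Type} [Field K] [CommRing R] [Algebra K R]
    [Algebra.FiniteType K R] [IrreducibleSpace (PrimeSpectrum R)] {f : R}
    (hf : ¬ IsNilpotent f) : topologicalKrullDim (PrimeSpectrum R) ≤
      topologicalKrullDim (PrimeSpectrum.basicOpen f : Set (PrimeSpectrum R)) := by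
  have hp : (nilradical R).IsPrime :=
    PrimeSpectrum.irreducibleSpace_iff_isPrime_nilradical.1 inferInstance
  let q := Ideal.Quotient.mk (nilradical R)
  have hq : IsHomeomorph (PrimeSpectrum.comap q) := by
    refine PrimeSpectrum.isHomeomorph_comap q (fun x => ?_) (Ideal.mk_ker).le
    obtain ⟨y, rfl⟩ := Ideal.Quotient.mk_surjective x
    exact ⟨1, one_pos, y, (pow_one _).symm⟩
  have hqf : q f ≠ 0 := fun h => hf (Ideal.Quotient.eq_zero_iff_mem.1 h)
  have h₁ := ringKrullDim_le_of_isLocalization_away (K := K)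
    (S := Localization.Away (q f)) hqf
  have h₂ := PrimeSpectrum.localization_away_isOpenEmbedding (Localization.Away (q f)) (q f)
  rw [← PrimeSpectrum.topologicalKrullDim_eq_ringKrullDim,
    ← PrimeSpectrum.topologicalKrullDim_eq_ringKrullDim,
    hq.topologicalKrullDim_eq] at h₁
  refine h₁.trans ?_
  have h₃ := hq.isInducing.comp h₂.isInducing
  refine (h₃.codRestrict (s := (PrimeSpectrum.basicOpen f : Set (PrimeSpectrum R))) fun x => ?_).topologicalKrullDim_le
  have : PrimeSpectrum.comap (algebraMap _ (Localization.Away (q f))) x ∈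
      PrimeSpectrum.basicOpen (q f) := by
    rw [← SetLike.mem_coe, ← PrimeSpectrum.localization_away_comap_range
      (Localization.Away (q f)) (q f)]
    exact ⟨x, rfl⟩
  exact this

theorem isIntegralElem_comp {R S T U : Type} [CommRing R] [CommRing S] [CommRing T] [CommRing U]
    {f : R →+* S} {g : T →+* U} {i : R →+* T} {j : S →+* U} (h : g.comp i = j.comp f) {x : S}
    (hx : f.IsIntegralElem x) : g.IsIntegralElem (j x) := by
  obtain ⟨p, hp, hpx⟩ := hx
  refine ⟨p.map i, hp.map i, ?_⟩
  rw [Polynomial.eval₂_map, h, ← Polynomial.hom_eval₂, hpx, map_zero]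

theorem ringKrullDim_tensorProduct_le {K R S : Type} [Field K] [CommRing R] [CommRing S]
    [Algebra K R] [Algebra K S] [Algebra.FiniteType K R] [Algebra.FiniteType K S] :
    ringKrullDim (TensorProduct K R S) ≤ ringKrullDim R + ringKrullDim S := by
  rcases subsingleton_or_nontrivial (TensorProduct K R S) with h | h
  · rw [ringKrullDim_eq_bot_of_subsingleton]; exact bot_le
  have hR : Nontrivial R := by
    by_contra hR
    rw [not_nontrivial_iff_subsingleton] at hR
    exact not_subsingleton _ (inferInstance : Subsingleton (TensorProduct K R S))
  have hS : Nontrivial S := by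
    by_contra hS
    rw [not_nontrivial_iff_subsingleton] at hS
    exact not_subsingleton _ (inferInstance : Subsingleton (TensorProduct K R S))
  obtain ⟨m, g, hgi, hg⟩ := exists_integral_inj_algHom_of_fg K R
  obtain ⟨n, k, hki, hk⟩ := exists_integral_inj_algHom_of_fg K S
  have : IsNoetherianRing R := Algebra.FiniteType.isNoetherianRing K R
  have : IsNoetherianRing S := Algebra.FiniteType.isNoetherianRing K S
  have h₁ : (Algebra.TensorProduct.map g k).toRingHom.IsIntegral := by
    intro x
    induction x with
    | zero => exact RingHom.isIntegralElem_zero _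
    | add x y hx hy => exact hx.add _ hy
    | tmul x y =>
      have : TensorProduct.tmul K x y =
          (Algebra.TensorProduct.includeLeft : R →ₐ[K] TensorProduct K R S) x *
          (Algebra.TensorProduct.includeRight : S →ₐ[K] TensorProduct K R S) y := by simp
      rw [this]
      refine RingHom.IsIntegralElem.mul _ ?_ ?_
      · refine isIntegralElem_comp (f := g.toRingHom)
          (i := (Algebra.TensorProduct.includeLeft : _ →ₐ[K] TensorProduct K _ _).toRingHom)
          (j := (Algebra.TensorProduct.includeLeft : R →ₐ[K] TensorProduct K R S).toRingHom)
          ?_ (hg x)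
        ext x <;> simp
      · refine isIntegralElem_comp (f := k.toRingHom)
          (i := (Algebra.TensorProduct.includeRight : _ →ₐ[K] TensorProduct K _ _).toRingHom)
          (j := (Algebra.TensorProduct.includeRight : S →ₐ[K] TensorProduct K R S).toRingHom)
          ?_ (hk y)
        refine RingHom.ext fun x => ?_
        simp
  have h₂ := ringKrullDim_le_of_isIntegral h₁
  have h₃ : ringKrullDim (TensorProduct K (MvPolynomial (Fin m) K) (MvPolynomial (Fin n) K)) =
      m + n := by
    rw [ringKrullDim_eq_of_ringEquiv
      (MvPolynomial.algebraTensorAlgEquiv K (MvPolynomial (Fin m) K) (σ := Fin n)).toRingEquiv,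
      MvPolynomial.ringKrullDim_of_isNoetherianRing, ringKrullDim_mvPolynomial_field]
    simp
  have h₄ := ringKrullDim_le_of_isIntegral_of_injective hg hgi
  have h₅ := ringKrullDim_le_of_isIntegral_of_injective hk hki
  rw [ringKrullDim_mvPolynomial_field] at h₄ h₅
  rw [h₃] at h₂
  refine h₂.trans (add_le_add ?_ ?_)
  · simpa using h₄
  · simpa using h₅

theorem ringKrullDim_lt_top_of_finiteType (K R : Type) [Field K] [CommRing R] [Algebra K R]
    [Algebra.FiniteType K R] : ringKrullDim R < ⊤ := by
  rcases subsingleton_or_nontrivial R with h | h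
  · rw [ringKrullDim_eq_bot_of_subsingleton]; exact bot_lt_top
  obtain ⟨m, g, hgi, hg⟩ := exists_integral_inj_algHom_of_fg K R
  refine (ringKrullDim_le_of_isIntegral hg).trans_lt ?_
  rw [ringKrullDim_mvPolynomial_field]
  exact WithBot.coe_lt_coe.2 (ENat.natCast_lt_top _)

/-- The Zariski topology on the set of `K`-points. -/
instance ptTopology (W : Over (SpecK K)) : TopologicalSpace (Pt K W) :=
  TopologicalSpace.induced (ev K) inferInstance

theorem isInducing_ev (W : Over (SpecK K)) : IsInducing (ev K : Pt K W → W.left) := ⟨rfl⟩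

theorem specPt_eq : specPt K = IsLocalRing.closedPoint K := Subsingleton.elim _ _

theorem ev_comp {W Z : Over (SpecK K)} (a : Pt K W) (F : W ⟶ Z) :
    ev K (a ≫ F) = F.left (ev K a) := by
  simp [ev]

theorem ev_injective [IsAlgClosed K] (W : Over (SpecK K)) [LocallyOfFiniteType W.hom] :
    Function.Injective (ev K : Pt K W → W.left) := by
  intro a b h
  ext1
  refine ext_of_apply_closedPoint_eq W.hom (Over.w a) (Over.w b) ?_
  rw [← specPt_eq]
  exact h

theorem range_ev [IsAlgClosed K] (W : Over (SpecK K)) [LocallyOfFiniteType W.hom] :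
    Set.range (ev K : Pt K W → W.left) = closedPoints W.left := by
  ext x
  constructor
  · rintro ⟨a, rfl⟩
    have h := (pointEquivClosedPoint W.hom ⟨a.left, Over.w a⟩).2
    simp only [pointEquivClosedPoint_apply_coe, ← specPt_eq] at h
    exact h
  · intro hx
    refine ⟨Over.homMk (pointOfClosedPoint W.hom x hx) (pointOfClosedPoint_comp W.hom x hx), ?_⟩
    exact pointOfClosedPoint_apply W.hom x hx _

theorem continuous_comp {W Z : Over (SpecK K)} (F : W ⟶ Z) :
    Continuous fun a : Pt K W => a ≫ F := by
  rw [(isInducing_ev K Z).continuous_iff]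
  have : (ev K ∘ fun a : Pt K W => a ≫ F) = F.left ∘ ev K := by
    ext a; exact ev_comp K a F
  rw [this]
  exact F.left.continuous.comp (isInducing_ev K W).continuous

theorem isProper_left {W Z : Over (SpecK K)} [IsProper W.hom] [IsProper Z.hom] (F : W ⟶ Z) :
    IsProper F.left := by
  have h : IsProper (F.left ≫ Z.hom) := by rw [Over.w F]; infer_instance
  exact IsProper.of_comp F.left Z.hom

theorem jacobsonSpace_left (W : Over (SpecK K)) [LocallyOfFiniteType W.hom] :
    JacobsonSpace W.left := LocallyOfFiniteType.jacobsonSpace W.hom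

theorem isClosedMap_comp [IsAlgClosed K] {W Z : Over (SpecK K)} [IsProper W.hom] [IsProper Z.hom]
    (F : W ⟶ Z) : IsClosedMap fun a : Pt K W => a ≫ F := by
  intro S hS
  obtain ⟨C, hC, rfl⟩ := (isInducing_ev K W).isClosed_iff.1 hS
  have := isProper_left K F
  have := jacobsonSpace_left K W
  have hFC : IsClosed (F.left '' C) := F.left.isClosedMap C hC
  convert hFC.preimage (isInducing_ev K Z).continuous using 1
  ext z
  constructor
  · rintro ⟨a, ha, rfl⟩
    exact ⟨ev K a, ha, (ev_comp K a F).symm⟩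
  · rintro ⟨x, hx, hxz⟩
    have hz : IsClosed {ev K z} := by
      have : ev K z ∈ closedPoints Z.left := range_ev K Z ▸ ⟨z, rfl⟩
      exact this
    have hcl : IsClosed (C ∩ F.left ⁻¹' {ev K z}) := hC.inter (hz.preimage F.left.continuous)
    obtain ⟨y, hy, hy'⟩ := nonempty_inter_closedPoints (Z := C ∩ F.left ⁻¹' {ev K z})
      ⟨x, hx, hxz⟩ hcl.isLocallyClosed
    rw [← range_ev K W] at hy'
    obtain ⟨a, rfl⟩ := hy'
    refine ⟨a, hy.1, ev_injective K Z ?_⟩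
    rw [ev_comp]
    exact hy.2

theorem t1Space_pt [IsAlgClosed K] (W : Over (SpecK K)) [LocallyOfFiniteType W.hom] :
    T1Space (Pt K W) := by
  refine ⟨fun a => ?_⟩
  have h : IsClosed {ev K a} := by
    have : ev K a ∈ closedPoints W.left := range_ev K W ▸ ⟨a, rfl⟩
    exact this
  convert h.preimage (isInducing_ev K W).continuous using 1
  ext b
  simp [(ev_injective K W).eq_iff]

theorem isNoetherian_left (W : Over (SpecK K)) [LocallyOfFiniteType W.hom] [QuasiCompact W.hom] :
    IsNoetherian W.left := by
  have h₁ : IsLocallyNoetherian W.left := LocallyOfFiniteType.isLocallyNoetherian W.hom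
  have h₂ : CompactSpace W.left := (quasiCompact_iff_compactSpace W.hom).1 inferInstance
  exact {}

theorem noetherianSpace_pt (W : Over (SpecK K)) [LocallyOfFiniteType W.hom]
    [QuasiCompact W.hom] : TopologicalSpace.NoetherianSpace (Pt K W) := by
  have := isNoetherian_left K W
  exact (isInducing_ev K W).noetherianSpace

theorem topologicalKrullDim_pt [IsAlgClosed K] (W : Over (SpecK K)) [LocallyOfFiniteType W.hom] :
    topologicalKrullDim (Pt K W) = topologicalKrullDim W.left := by
  have := jacobsonSpace_left K W
  exact topologicalKrullDim_eq_of_closedPoints (isInducing_ev K W) (range_ev K W).ge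

theorem irreducibleSpace_left [IsAlgClosed K] (W : Over (SpecK K)) [LocallyOfFiniteType W.hom]
    [IrreducibleSpace (Pt K W)] : IrreducibleSpace W.left := by
  have := jacobsonSpace_left K W
  have h : IsIrreducible (Set.range (ev K : Pt K W → W.left)) := by
    rw [← Set.image_univ]
    exact (IrreducibleSpace.isIrreducible_univ _).image _ (isInducing_ev K W).continuous.continuousOn
  have h' := h.closure
  rw [range_ev, closure_closedPoints] at h'
  exact (irreducibleSpace_def _).2 h'

theorem irreducibleSpace_pt [IsAlgClosed K] (W : Over (SpecK K)) [LocallyOfFiniteType W.hom]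
    [IrreducibleSpace W.left] : IrreducibleSpace (Pt K W) := by
  have := jacobsonSpace_left K W
  have key : ∀ U : Set W.left, IsOpen U → U.Nonempty → (ev K ⁻¹' U : Set (Pt K W)).Nonempty := by
    intro U hU hne
    obtain ⟨x, hx, hx'⟩ := nonempty_inter_closedPoints hne hU.isLocallyClosed
    rw [← range_ev K W] at hx'
    obtain ⟨a, rfl⟩ := hx'
    exact ⟨a, hx⟩
  refine (irreducibleSpace_def _).2 ⟨?_, ?_⟩
  · exact key Set.univ isOpen_univ Set.univ_nonempty
  · rintro U U' hU hU' ⟨a, -, ha⟩ ⟨b, -, hb⟩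
    obtain ⟨O, hO, rfl⟩ := (isInducing_ev K W).isOpen_iff.1 hU
    obtain ⟨O', hO', rfl⟩ := (isInducing_ev K W).isOpen_iff.1 hU'
    obtain ⟨c, hc⟩ := key _ (hO.inter hO') (nonempty_preirreducible_inter hO hO' ⟨_, ha⟩ ⟨_, hb⟩)
    exact ⟨c, trivial, hc⟩

theorem exists_algebra_of_hom_specK {R : CommRingCat} (g : Spec R ⟶ SpecK K)
    [LocallyOfFiniteType g] :
    ∃ _ : Algebra K R, Algebra.FiniteType K R ∧
      g = Spec.map (CommRingCat.ofHom (algebraMap K R)) := by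
  obtain ⟨φ, rfl⟩ := Spec.map_surjective g
  have h : φ.hom.FiniteType := (HasRingHomProperty.Spec_iff (P := @LocallyOfFiniteType)).1 ‹_›
  exact ⟨φ.hom.toAlgebra, h, rfl⟩

theorem topologicalKrullDim_le_of_isOpenImmersion {X Y : Scheme} (f : X ⟶ Y) [IsOpenImmersion f] :
    topologicalKrullDim X ≤ topologicalKrullDim Y :=
  f.isOpenEmbedding.isInducing.topologicalKrullDim_le

theorem exists_spec_nhds (Y : Scheme) (y : Y) :
    ∃ (R : CommRingCat) (j : Spec R ⟶ Y), IsOpenImmersion j ∧ y ∈ Set.range j :=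
  ⟨_, Y.affineOpenCover.f (Y.affineOpenCover.idx y), inferInstance, Y.affineOpenCover.covers y⟩

theorem topologicalKrullDim_le_isOpen {Y : Scheme} (g : Y ⟶ SpecK K) [LocallyOfFiniteType g]
    [IrreducibleSpace Y] {U : Set Y} (hU : IsOpen U) (hne : U.Nonempty) :
    topologicalKrullDim Y ≤ topologicalKrullDim U := by
  refine topologicalKrullDim_le_of_nhds fun y => ?_
  obtain ⟨R, j, hj', hy⟩ := exists_spec_nhds Y y
  have hj : IsOpenEmbedding j := j.isOpenEmbedding
  refine ⟨Set.range j, hj.isOpen_range, hy, ?_⟩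
  obtain ⟨_, _, -⟩ := exists_algebra_of_hom_specK K (j ≫ g)
  have hirr : IrreducibleSpace (PrimeSpectrum R) := by
    have h₁ : IsPreirreducible (Set.range j) :=
      (PreirreducibleSpace.isPreirreducible_univ (X := Y)).open_subset hj.isOpen_range
        (Set.subset_univ _)
    have h₂ := h₁.preimage (f := j) hj
    rw [Set.preimage_range] at h₂
    obtain ⟨x, -⟩ := hy
    exact (irreducibleSpace_def _).2 ⟨⟨x, trivial⟩, h₂⟩
  have hne' : (j ⁻¹' U).Nonempty := by
    obtain ⟨_, ⟨x, rfl⟩, hx⟩ := nonempty_preirreducible_inter hj.isOpen_range hU ⟨y, hy⟩ hne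
    exact ⟨x, hx⟩
  obtain ⟨x, hx⟩ := hne'
  obtain ⟨_, ⟨f, rfl⟩, hxf, hfU⟩ := PrimeSpectrum.isTopologicalBasis_basic_opens.exists_subset_of_mem_open
    (show (x : PrimeSpectrum R) ∈ (j ⁻¹' U : Set (PrimeSpectrum R)) from hx)
    (hU.preimage j.continuous)
  have hf : ¬ IsNilpotent f := fun h => by
    obtain ⟨n, hn⟩ := h
    have hx' : f ∉ (show PrimeSpectrum R from x).asIdeal := hxf
    exact hx' ((show PrimeSpectrum R from x).2.mem_of_pow_mem n (hn ▸ zero_mem _))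
  have h₁ := topologicalKrullDim_le_basicOpen (K := K) hf
  have h₂ : topologicalKrullDim (Set.range j) = topologicalKrullDim (PrimeSpectrum R) :=
    (hj.isEmbedding.toHomeomorph.isHomeomorph.topologicalKrullDim_eq).symm
  rw [h₂]
  refine h₁.trans ?_
  have h₃ : IsInducing fun z : (PrimeSpectrum.basicOpen f : Set (PrimeSpectrum R)) => j z.1 :=
    hj.isInducing.comp IsInducing.subtypeVal
  exact (h₃.codRestrict (s := U) fun z => hfU z.2).topologicalKrullDim_le

theorem topologicalKrullDim_lt_top {Y : Scheme} (g : Y ⟶ SpecK K) [LocallyOfFiniteType g]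
    [IrreducibleSpace Y] : topologicalKrullDim Y < ⊤ := by
  obtain ⟨y⟩ : Nonempty Y := inferInstance
  obtain ⟨R, j, hj', hy⟩ := exists_spec_nhds Y y
  obtain ⟨_, _, -⟩ := exists_algebra_of_hom_specK K (j ≫ g)
  refine (topologicalKrullDim_le_isOpen K g j.isOpenEmbedding.isOpen_range ⟨y, hy⟩).trans_lt ?_
  have h₂ : topologicalKrullDim (Set.range j) = topologicalKrullDim (PrimeSpectrum R) :=
    (j.isOpenEmbedding.isEmbedding.toHomeomorph.isHomeomorph.topologicalKrullDim_eq).symm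
  rw [h₂, PrimeSpectrum.topologicalKrullDim_eq_ringKrullDim]
  exact ringKrullDim_lt_top_of_finiteType K R

theorem topologicalKrullDim_pullback_spec_le {R S : CommRingCat} (f : Spec R ⟶ SpecK K)
    (g : Spec S ⟶ SpecK K) [LocallyOfFiniteType f] [LocallyOfFiniteType g] :
    topologicalKrullDim ↥(pullback f g) ≤
      topologicalKrullDim (Spec R) + topologicalKrullDim (Spec S) := by
  obtain ⟨_, _, rfl⟩ := exists_algebra_of_hom_specK K f
  obtain ⟨_, _, rfl⟩ := exists_algebra_of_hom_specK K g
  refine (topologicalKrullDim_le_of_isOpenImmersion (pullbackSpecIso K R S).hom).trans ?_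
  have := ringKrullDim_tensorProduct_le (K := K) (R := R) (S := S)
  rw [← PrimeSpectrum.topologicalKrullDim_eq_ringKrullDim,
    ← PrimeSpectrum.topologicalKrullDim_eq_ringKrullDim,
    ← PrimeSpectrum.topologicalKrullDim_eq_ringKrullDim] at this
  exact this

theorem topologicalKrullDim_pullback_le {X Y : Scheme} (f : X ⟶ SpecK K) (g : Y ⟶ SpecK K)
    [LocallyOfFiniteType f] [LocallyOfFiniteType g] :
    topologicalKrullDim ↥(pullback f g) ≤ topologicalKrullDim X + topologicalKrullDim Y := by
  let 𝒰 := Scheme.Pullback.openCoverOfLeftRight X.affineOpenCover.openCover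
    Y.affineOpenCover.openCover f g
  refine topologicalKrullDim_le_of_nhds fun z => ?_
  have hj := (𝒰.f (𝒰.idx z)).isOpenEmbedding
  refine ⟨Set.range (𝒰.f (𝒰.idx z)), hj.isOpen_range, 𝒰.covers z, ?_⟩
  have h₂ : topologicalKrullDim (Set.range (𝒰.f (𝒰.idx z))) =
      topologicalKrullDim (𝒰.X (𝒰.idx z)) :=
    (hj.isEmbedding.toHomeomorph.isHomeomorph.topologicalKrullDim_eq).symm
  rw [h₂]
  obtain ⟨i, hi⟩ : ∃ i : X.affineOpenCover.I₀, i = (𝒰.idx z).1 := ⟨_, rfl⟩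
  obtain ⟨k, hk⟩ : ∃ k : Y.affineOpenCover.I₀, k = (𝒰.idx z).2 := ⟨_, rfl⟩
  have h := topologicalKrullDim_pullback_spec_le K (X.affineOpenCover.f i ≫ f)
    (Y.affineOpenCover.f k ≫ g)
  have h' := h.trans (add_le_add
    (topologicalKrullDim_le_of_isOpenImmersion (X.affineOpenCover.f i))
    (topologicalKrullDim_le_of_isOpenImmersion (Y.affineOpenCover.f k)))
  subst hi hk
  exact h'

/-- The projections of a fibered power. -/
def powProj (Ω : Type) [Finite Ω] (i : Ω) : pow K V Ω ⟶ V :=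
  Pi.π (fun _ : Ω => V) i

variable {V} in
/-- The morphism to a fibered power with given components. -/
def powLift (Ω : Type) [Finite Ω] {W : Over (SpecK K)} (f : Ω → (W ⟶ V)) : W ⟶ pow K V Ω :=
  Pi.lift f

variable {V} in
@[simp]
theorem powLift_powProj (Ω : Type) [Finite Ω] {W : Over (SpecK K)} (f : Ω → (W ⟶ V)) (i : Ω) :
    powLift K Ω f ≫ powProj K V Ω i = f i :=
  limit.lift_π _ _

variable {V} in
theorem pow_hom_ext {Ω : Type} [Finite Ω] {W : Over (SpecK K)} {f g : W ⟶ pow K V Ω}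
    (h : ∀ i, f ≫ powProj K V Ω i = g ≫ powProj K V Ω i) : f = g :=
  Pi.hom_ext _ _ h

/-- Reindexing of fibered powers along a map of index sets. -/
def powMap {Ω Λ : Type} [Finite Ω] [Finite Λ] (r : Λ → Ω) : pow K V Ω ⟶ pow K V Λ :=
  powLift K Λ fun l => powProj K V Ω (r l)

@[simp]
theorem powMap_powProj {Ω Λ : Type} [Finite Ω] [Finite Λ] (r : Λ → Ω) (i : Λ) :
    powMap K V r ≫ powProj K V Λ i = powProj K V Ω (r i) :=
  powLift_powProj K _ _ _

/-- Reindexing of fibered powers along an equivalence. -/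
def powIso {Ω Λ : Type} [Finite Ω] [Finite Λ] (e : Ω ≃ Λ) : pow K V Ω ≅ pow K V Λ where
  hom := powMap K V e.symm
  inv := powMap K V e
  hom_inv_id := pow_hom_ext K fun i => by simp
  inv_hom_id := pow_hom_ext K fun i => by simp

/-- The fibered product over the base, as a scheme over the base. -/
def overProd (W V : Over (SpecK K)) : Over (SpecK K) :=
  Over.mk (pullback.fst W.hom V.hom ≫ W.hom)

/-- The first projection. -/
def overFst (W V : Over (SpecK K)) : overProd K W V ⟶ W :=
  Over.homMk (pullback.fst W.hom V.hom) rfl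

/-- The second projection. -/
def overSnd (W V : Over (SpecK K)) : overProd K W V ⟶ V :=
  Over.homMk (pullback.snd W.hom V.hom) pullback.condition.symm

variable {V} in
/-- The morphism to a fibered product with given components. -/
def overLift {W Z : Over (SpecK K)} (f : Z ⟶ W) (g : Z ⟶ V) : Z ⟶ overProd K W V :=
  Over.homMk (pullback.lift f.left g.left ((Over.w f).trans (Over.w g).symm))
    ((pullback.lift_fst_assoc _ _ _ _).trans (Over.w f))

variable {V} in
@[simp]
theorem overLift_fst {W Z : Over (SpecK K)} (f : Z ⟶ W) (g : Z ⟶ V) :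
    overLift K f g ≫ overFst K W V = f :=
  Over.OverMorphism.ext (pullback.lift_fst _ _ _)

variable {V} in
@[simp]
theorem overLift_snd {W Z : Over (SpecK K)} (f : Z ⟶ W) (g : Z ⟶ V) :
    overLift K f g ≫ overSnd K W V = g :=
  Over.OverMorphism.ext (pullback.lift_snd _ _ _)

variable {V} in
theorem overProd_hom_ext {W Z : Over (SpecK K)} {f g : Z ⟶ overProd K W V}
    (h₁ : f ≫ overFst K W V = g ≫ overFst K W V) (h₂ : f ≫ overSnd K W V = g ≫ overSnd K W V) :
    f = g :=
  Over.OverMorphism.ext (pullback.hom_ext (congrArg CommaMorphism.left h₁)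
    (congrArg CommaMorphism.left h₂))

/-- The fibered power over an index set with one more element is a fibered product. -/
def powOptionIso (Ω : Type) [Finite Ω] : pow K V (Option Ω) ≅ overProd K (pow K V Ω) V where
  hom := overLift K (powMap K V some) (powProj K V _ none)
  inv := powLift K _ fun o => o.elim (overSnd K _ V) fun ω => overFst K _ V ≫ powProj K V Ω ω
  hom_inv_id := pow_hom_ext K fun o => by
    rw [Category.assoc, powLift_powProj]
    cases o
    · simp
    · simp [← Category.assoc]
  inv_hom_id := overProd_hom_ext K
    (pow_hom_ext K fun i => by simp)
    (by simp)

/-- The fibered power over the empty index set is the base. -/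
def powEmptyIso : pow K V PEmpty ≅ Over.mk (𝟙 (SpecK K)) where
  hom := Over.homMk (pow K V PEmpty).hom
  inv := powLift K _ fun x => x.elim
  hom_inv_id := pow_hom_ext K fun x => x.elim
  inv_hom_id := Over.OverMorphism.ext (Over.w _)

theorem isProper_of_iso {W Z : Over (SpecK K)} (e : W ≅ Z) (h : IsProper Z.hom) :
    IsProper W.hom := by
  have : IsIso e.hom.left := inferInstanceAs (IsIso ((Over.forget _).map e.hom))
  rw [← Over.w e.hom]
  infer_instance

theorem topologicalKrullDim_eq_of_iso {W Z : Over (SpecK K)} (e : W ≅ Z) :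
    topologicalKrullDim W.left = topologicalKrullDim Z.left := by
  have : IsIso e.hom.left := inferInstanceAs (IsIso ((Over.forget _).map e.hom))
  have : IsIso e.inv.left := inferInstanceAs (IsIso ((Over.forget _).map e.inv))
  exact le_antisymm (topologicalKrullDim_le_of_isOpenImmersion e.hom.left)
    (topologicalKrullDim_le_of_isOpenImmersion e.inv.left)

instance isProper_pow (Ω : Type) [Finite Ω] [IsProper V.hom] : IsProper (pow K V Ω).hom := by
  refine Finite.induction_empty_option (P := fun Ω => ∀ [Finite Ω], IsProper (pow K V Ω).hom)
    (fun {α β} e h _ => ?_) ?_ (fun {α} _ h _ => ?_) Ω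
  · have : Finite α := Finite.of_equiv _ e.symm
    exact isProper_of_iso K (powIso K V e).symm h
  · intro _
    refine isProper_of_iso K (powEmptyIso K V) ?_
    dsimp
    infer_instance
  · refine isProper_of_iso K (powOptionIso K V α) ?_
    have : IsProper (pow K V α).hom := h
    dsimp [overProd]
    infer_instance

theorem topologicalKrullDim_pow_le (Ω : Type) [Finite Ω] [IsProper V.hom] {d : ℕ}
    (hd : topologicalKrullDim V.left ≤ d) :
    topologicalKrullDim (pow K V Ω).left ≤ (Nat.card Ω * d : ℕ) := by
  refine Finite.induction_empty_option (P := fun Ω => ∀ [Finite Ω],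
    topologicalKrullDim (pow K V Ω).left ≤ (Nat.card Ω * d : ℕ))
    (fun {α β} e h _ => ?_) ?_ (fun {α} _ h _ => ?_) Ω
  · have : Finite α := Finite.of_equiv _ e.symm
    rw [← topologicalKrullDim_eq_of_iso K (powIso K V e), ← Nat.card_congr e]
    exact h
  · intro _
    rw [topologicalKrullDim_eq_of_iso K (powEmptyIso K V)]
    have : topologicalKrullDim (SpecK K) = 0 :=
      (PrimeSpectrum.topologicalKrullDim_eq_ringKrullDim K).trans (ringKrullDim_eq_zero_of_field K)
    simpa using this.le
  · rw [topologicalKrullDim_eq_of_iso K (powOptionIso K V _)]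
    refine (topologicalKrullDim_pullback_le K _ _).trans ((add_le_add h hd).trans ?_)
    rw [Nat.card_eq_fintype_card, Nat.card_eq_fintype_card, Fintype.card_option]
    exact_mod_cast (by lia : Fintype.card α * d + d ≤ (Fintype.card α + 1) * d)

theorem exists_notMem_of_krullDim_range_lt [IsAlgClosed K] {Y Z : Over (SpecK K)} [IsProper Y.hom]
    [IsProper Z.hom] [IrreducibleSpace Y.left] (F : Y ⟶ Z) {U : Y.left.Opens}
    (hU : IsAffineOpen U) (hdim : topologicalKrullDim (Set.range fun a : Pt K Y => a ≫ F) <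
      topologicalKrullDim (Pt K Y)) (y : Pt K Y) : ∃ y' : Pt K Y, ev K y' ∉ U ∧ y' ≫ F = y ≫ F := by
  by_contra! hcon
  have := isProper_left K F
  have := jacobsonSpace_left K Y
  have := jacobsonSpace_left K Z
  have hz : IsClosed {ev K (y ≫ F)} := by
    have : ev K (y ≫ F) ∈ closedPoints Z.left := range_ev K Z ▸ ⟨_, rfl⟩
    exact this
  have hlift : ∀ x ∈ closedPoints Y.left, ∃ a : Pt K Y, ev K a = x := fun x hx => by
    rw [← range_ev K Y] at hx; exact hx
  have hfib : F.left ⁻¹' {ev K (y ≫ F)} ⊆ U := by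
    by_contra hsub
    obtain ⟨x, hx, hxU⟩ := Set.not_subset.1 hsub
    have hcl : IsClosed (F.left ⁻¹' {ev K (y ≫ F)} ∩ (U : Set Y.left)ᶜ) :=
      (hz.preimage F.left.continuous).inter U.2.isClosed_compl
    obtain ⟨x', hx', hx''⟩ := nonempty_inter_closedPoints
      (Z := F.left ⁻¹' {ev K (y ≫ F)} ∩ (U : Set Y.left)ᶜ) ⟨x, hx, hxU⟩ hcl.isLocallyClosed
    obtain ⟨a, rfl⟩ := hlift x' hx''
    refine hcon a hx'.2 (ev_injective K Z ?_)
    rw [ev_comp]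
    exact hx'.1
  have hC : IsClosed (F.left '' (U : Set Y.left)ᶜ) := F.left.isClosedMap _ U.2.isClosed_compl
  obtain ⟨V', hV', hzV', hV'C⟩ := exists_isAffineOpen_mem_and_subset
    (U := ⟨(F.left '' (U : Set Y.left)ᶜ)ᶜ, hC.isOpen_compl⟩) (x := ev K (y ≫ F)) (by
      rintro ⟨x, hx, hx'⟩
      exact hx (hfib hx'))
  have hFU : F.left ⁻¹ᵁ V' ≤ U := fun x hx => by
    by_contra hxU
    exact hV'C hx ⟨x, hxU, rfl⟩
  have hVaff : IsAffineOpen (F.left ⁻¹ᵁ V') := by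
    have : IsAffine U := hU
    have : IsAffineHom ((U.ι ≫ F.left) ≫ Z.hom) := inferInstance
    have hUF : IsAffineHom (U.ι ≫ F.left) := IsAffineHom.of_comp (U.ι ≫ F.left) Z.hom
    have h₁ := (hUF.isAffine_preimage V' hV').image_of_isOpenImmersion U.ι
    convert h₁ using 1
    rw [Scheme.Hom.comp_preimage, Scheme.Hom.image_preimage_eq_opensRange_inf,
      Scheme.Opens.opensRange_ι, inf_eq_right.2 hFU]
  have : IsAffine (F.left ⁻¹ᵁ V') := hVaff
  have : IsAffine V' := hV'
  have hfin : IsFinite (F.left ∣_ V') :=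
    IsFinite.iff_isProper_and_isAffineHom.2 ⟨inferInstance, inferInstance⟩
  have hspec : ∀ x x' : (F.left ⁻¹ᵁ V').toScheme, x ⤳ x' →
      (F.left ∣_ V') x = (F.left ∣_ V') x' → x = x' := by
    intro x x' hxx' he
    have hd := (F.left ∣_ V').isDiscrete_preimage_singleton ((F.left ∣_ V') x')
    have := hd.to_subtype
    have hs : (⟨x, he⟩ : (F.left ∣_ V') ⁻¹' {(F.left ∣_ V') x'}) ⤳ ⟨x', rfl⟩ :=
      (subtype_specializes_iff _ _).2 hxx'
    exact congrArg Subtype.val hs.eq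
  have h₁ := topologicalKrullDim_le_range (F.left ∣_ V').continuous hspec
  have h₂ : topologicalKrullDim (Set.range (F.left ∣_ V')) ≤
      topologicalKrullDim (Set.range F.left) := by
    let j : Set.range (F.left ∣_ V') → Set.range F.left := fun z => ⟨z.1.1, by
      obtain ⟨_, x, rfl⟩ := z
      exact ⟨x.1, (morphismRestrict_base_coe F.left V' x).symm⟩⟩
    have hj : IsInducing (Subtype.val ∘ j) :=
      (V'.isOpenEmbedding'.isInducing.comp IsInducing.subtypeVal : _)
    exact (IsInducing.subtypeVal.of_comp_iff.1 hj).topologicalKrullDim_le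
  have h₃ : topologicalKrullDim (Set.range fun a : Pt K Y => a ≫ F) =
      topologicalKrullDim (Set.range F.left) := by
    have hc : IsClosed (Set.range F.left) := F.left.isClosedMap.isClosed_range
    have : JacobsonSpace (Set.range F.left) := .of_isClosedEmbedding hc.isClosedEmbedding_subtypeVal
    let j : (Set.range fun a : Pt K Y => a ≫ F) → Set.range F.left := fun z => ⟨ev K z.1, by
      obtain ⟨_, a, rfl⟩ := z
      exact ⟨ev K a, (ev_comp K a F).symm⟩⟩
    have hj : IsInducing (Subtype.val ∘ j) := (isInducing_ev K Z).comp IsInducing.subtypeVal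
    refine topologicalKrullDim_eq_of_closedPoints (IsInducing.subtypeVal.of_comp_iff.1 hj) ?_
    rintro ⟨_, x, rfl⟩ hx
    have hx' : IsClosed {F.left x} := by
      have := hc.isClosedEmbedding_subtypeVal.isClosedMap _ (mem_closedPoints_iff.1 hx)
      rwa [Set.image_singleton] at this
    obtain ⟨x', hx', hx''⟩ := nonempty_inter_closedPoints (Z := F.left ⁻¹' {F.left x})
      ⟨x, rfl⟩ (hx'.preimage F.left.continuous).isLocallyClosed
    obtain ⟨a, rfl⟩ := hlift x' hx''
    exact ⟨⟨a ≫ F, a, rfl⟩, Subtype.ext ((ev_comp K a F).trans hx')⟩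
  have h₄ : topologicalKrullDim Y.left ≤ topologicalKrullDim (F.left ⁻¹ᵁ V' : Set Y.left) :=
    topologicalKrullDim_le_isOpen K Y.hom (F.left ⁻¹ᵁ V').2 ⟨ev K y, by
      rw [ev_comp] at hzV'; exact hzV'⟩
  rw [h₃, topologicalKrullDim_pt K Y] at hdim
  exact absurd (h₄.trans (h₁.trans h₂)) hdim.not_ge

section Regular

variable {Ω Λ M : Type} [Finite Ω] [Finite Λ] [Finite M]

/-- The Zariski topology on `A^Ω`; it takes precedence over the product topology. -/
instance (priority := high) cfgTopology (Ω : Type) [Finite Ω] : TopologicalSpace (Ω → Pt K V) :=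
  cfgTop K V Ω

theorem ptPow_powProj (u : Ω → Pt K V) (i : Ω) : ptPow K V Ω u ≫ powProj K V Ω i = u i :=
  powLift_powProj K Ω u i

/-- The identification of `A^Ω` with the points of the fibered power. -/
def ptPowHomeo (Ω : Type) [Finite Ω] : (Ω → Pt K V) ≃ₜ Pt K (pow K V Ω) :=
  Equiv.toHomeomorphOfIsInducing
    { toFun := ptPow K V Ω
      invFun := fun a i => a ≫ powProj K V Ω i
      left_inv := fun u => funext fun i => ptPow_powProj K V u i
      right_inv := fun _ => pow_hom_ext K fun i => ptPow_powProj K V _ i }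
    ⟨(induced_compose (f := ptPow K V Ω) (g := ev K)).symm⟩

/-- A map `A^Ω → A` is regular if it is induced by a morphism `X^Ω → X`. -/
def IsRegFun (φ : (Ω → Pt K V) → Pt K V) : Prop :=
  ∃ f : pow K V Ω ⟶ V, ∀ u, φ u = ptPow K V Ω u ≫ f

/-- A map `A^Ω → A^Λ` is regular if it is induced by a morphism `X^Ω → X^Λ`. -/
def IsReg (Φ : (Ω → Pt K V) → (Λ → Pt K V)) : Prop :=
  ∃ F : pow K V Ω ⟶ pow K V Λ, ∀ u, ptPow K V Λ (Φ u) = ptPow K V Ω u ≫ F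

variable {V} in
/-- The constant morphism with value a given point. -/
def constHom (W : Over (SpecK K)) (a : Pt K V) : W ⟶ V :=
  Over.mkIdTerminal.from W ≫ a

variable {V} in
theorem comp_constHom {W : Over (SpecK K)} (b : Pt K W) (a : Pt K V) :
    b ≫ constHom K W a = a := by
  rw [constHom, ← Category.assoc, Over.mkIdTerminal.hom_ext (b ≫ _) (𝟙 _), Category.id_comp]

variable {K V}

theorem isRegFun_apply (i : Ω) : IsRegFun K V fun u : Ω → Pt K V => u i :=
  ⟨powProj K V Ω i, fun u => (ptPow_powProj K V u i).symm⟩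

theorem isRegFun_const (a : Pt K V) : IsRegFun K V fun _ : Ω → Pt K V => a :=
  ⟨constHom K _ a, fun _ => (comp_constHom K _ a).symm⟩

theorem isReg_of_isRegFun {Φ : (Ω → Pt K V) → (Λ → Pt K V)}
    (h : ∀ l, IsRegFun K V fun u => Φ u l) : IsReg K V Φ := by
  choose f hf using h
  refine ⟨powLift K Λ f, fun u => pow_hom_ext K fun i => ?_⟩
  rw [Category.assoc, powLift_powProj, ptPow_powProj]
  exact hf i u

theorem IsRegFun.comp (f : pow K V M ⟶ V) {ψ : (Ω → Pt K V) → (M → Pt K V)}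
    (h : ∀ m, IsRegFun K V fun u => ψ u m) : IsRegFun K V fun u => ptPow K V M (ψ u) ≫ f := by
  obtain ⟨F, hF⟩ := isReg_of_isRegFun h
  exact ⟨F ≫ f, fun u => (congrArg (· ≫ f) (hF u)).trans (Category.assoc _ _ _)⟩

theorem IsReg.continuous {Φ : (Ω → Pt K V) → (Λ → Pt K V)} (h : IsReg K V Φ) : Continuous Φ := by
  obtain ⟨F, hF⟩ := h
  have : Φ = (ptPowHomeo K V Λ).symm ∘ (fun a => a ≫ F) ∘ ptPowHomeo K V Ω := by
    ext1 u
    exact (ptPowHomeo K V Λ).eq_symm_apply.2 (hF u)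
  rw [this]
  exact (ptPowHomeo K V Λ).symm.continuous.comp
    ((continuous_comp K F).comp (ptPowHomeo K V Ω).continuous)

theorem continuous_apply_cfg (i : Ω) : Continuous fun u : Ω → Pt K V => u i := by
  have : (fun u : Ω → Pt K V => u i) = (fun a => a ≫ powProj K V Ω i) ∘ ptPowHomeo K V Ω := by
    ext1 u
    exact (ptPow_powProj K V u i).symm
  rw [this]
  exact (continuous_comp K _).comp (ptPowHomeo K V Ω).continuous

open scoped Classical in
theorem continuous_update_cfg (u : Ω → Pt K V) (s : Ω) :
    Continuous fun a : Pt K V => Function.update u s a := by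
  let F : V ⟶ pow K V Ω := powLift K Ω fun i => if i = s then 𝟙 V else constHom K V (u i)
  have : (fun a : Pt K V => Function.update u s a) =
      (ptPowHomeo K V Ω).symm ∘ (fun a => a ≫ F) := by
    ext1 a
    refine (ptPowHomeo K V Ω).eq_symm_apply.2 (pow_hom_ext K fun i => ?_)
    refine (ptPow_powProj K V _ i).trans ?_
    rw [Category.assoc, powLift_powProj]
    by_cases h : i = s
    · subst h; simp
    · simp [h, comp_constHom]
  rw [this]
  exact (ptPowHomeo K V Ω).symm.continuous.comp (continuous_comp K F)

/-- Combine two configurations, using the first one on a given set. -/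
def mix (S : Set Ω) (u v : Ω → Pt K V) : Ω → Pt K V :=
  open scoped Classical in fun i => if i ∈ S then u i else v i

theorem continuous_mix_left (S : Set Ω) (v : Ω → Pt K V) : Continuous fun u => mix S u v :=
  IsReg.continuous <| isReg_of_isRegFun fun l => by
    by_cases h : l ∈ S
    · simpa only [mix, h, if_true] using isRegFun_apply l
    · simpa only [mix, h, if_false] using isRegFun_const (v l)

theorem continuous_mix_right (S : Set Ω) (u : Ω → Pt K V) : Continuous (mix S u) :=
  IsReg.continuous <| isReg_of_isRegFun fun l => by
    by_cases h : l ∈ S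
    · simpa only [mix, h, if_true] using isRegFun_const (u l)
    · simpa only [mix, h, if_false] using isRegFun_apply l

open scoped Classical in
theorem continuous_update_cfg_right (s : Ω) (a : Pt K V) :
    Continuous fun u : Ω → Pt K V => Function.update u s a :=
  IsReg.continuous <| isReg_of_isRegFun fun l => by
    by_cases h : l = s
    · subst h; simpa using isRegFun_const a
    · simpa [h] using isRegFun_apply l

open scoped Classical in
theorem isIrreducible_box {D : Ω → Set (Pt K V)} (hD : ∀ i, IsIrreducible (D i)) :
    IsIrreducible {u : Ω → Pt K V | ∀ i, u i ∈ D i} := by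
  have := Fintype.ofFinite Ω
  choose u₀ hu₀ using fun i => (hD i).nonempty
  have key : ∀ S : Finset Ω, IsIrreducible
      {u : Ω → Pt K V | (∀ i ∈ S, u i ∈ D i) ∧ ∀ i ∉ S, u i = u₀ i} := by
    intro S
    induction S using Finset.induction with
    | empty =>
      convert isIrreducible_singleton (x := u₀) using 1
      ext u
      simp [funext_iff]
    | insert s S hs ih =>
      convert isIrreducible_image2 (m := fun a (u : Ω → Pt K V) => Function.update u s a)
        (fun u => continuous_update_cfg u s) (continuous_update_cfg_right s) (hD s) ih using 1
      ext w
      constructor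
      · rintro ⟨h₁, h₂⟩
        refine ⟨w s, h₁ s (Finset.mem_insert_self _ _), Function.update w s (u₀ s), ⟨?_, ?_⟩, ?_⟩
        · intro i hi
          rw [Function.update_of_ne (ne_of_mem_of_not_mem hi hs)]
          exact h₁ i (Finset.mem_insert_of_mem hi)
        · intro i hi
          by_cases h : i = s
          · subst h; simp
          · rw [Function.update_of_ne h]
            exact h₂ i (by simp [h, hi])
        · simp
      · rintro ⟨a, ha, u, ⟨h₁, h₂⟩, rfl⟩
        refine ⟨fun i hi => ?_, fun i hi => ?_⟩
        · by_cases h : i = s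
          · subst h; simpa using ha
          · simpa [h] using h₁ i (by simpa [h] using hi)
        · rw [Finset.mem_insert, not_or] at hi
          simpa [hi.1] using h₂ i hi.2
  simpa using key Finset.univ

variable [IsAlgClosed K] [IsProper V.hom]

theorem IsReg.isClosedMap {Φ : (Ω → Pt K V) → (Λ → Pt K V)} (h : IsReg K V Φ) :
    IsClosedMap Φ := by
  obtain ⟨F, hF⟩ := h
  have : Φ = (ptPowHomeo K V Λ).symm ∘ (fun a => a ≫ F) ∘ ptPowHomeo K V Ω := by
    ext1 u
    exact (ptPowHomeo K V Λ).eq_symm_apply.2 (hF u)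
  rw [this]
  exact (ptPowHomeo K V Λ).symm.isClosedMap.comp
    ((isClosedMap_comp K F).comp (ptPowHomeo K V Ω).isClosedMap)

theorem isClosedMap_apply_cfg (i : Ω) : IsClosedMap fun u : Ω → Pt K V => u i := by
  have : (fun u : Ω → Pt K V => u i) = (fun a => a ≫ powProj K V Ω i) ∘ ptPowHomeo K V Ω := by
    ext1 u
    exact (ptPow_powProj K V u i).symm
  rw [this]
  exact (isClosedMap_comp K _).comp (ptPowHomeo K V Ω).isClosedMap

instance t1Space_cfg : T1Space (Ω → Pt K V) :=
  have := t1Space_pt K (pow K V Ω)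
  (ptPowHomeo K V Ω).isEmbedding.t1Space

instance noetherianSpace_cfg : TopologicalSpace.NoetherianSpace (Ω → Pt K V) :=
  have := noetherianSpace_pt K (pow K V Ω)
  (ptPowHomeo K V Ω).isInducing.noetherianSpace

theorem topologicalKrullDim_cfg (Ω : Type) [Finite Ω] :
    topologicalKrullDim (Ω → Pt K V) = topologicalKrullDim (pow K V Ω).left :=
  ((ptPowHomeo K V Ω).isHomeomorph.topologicalKrullDim_eq).trans (topologicalKrullDim_pt K _)

theorem IsReg.exists_notMem_of_krullDim_range_lt [IrreducibleSpace (Ω → Pt K V)]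
    {Φ : (Ω → Pt K V) → (Λ → Pt K V)} (h : IsReg K V Φ)
    (hdim : topologicalKrullDim (Set.range Φ) < topologicalKrullDim (Ω → Pt K V))
    {U : (pow K V Ω).left.Opens} (hU : IsAffineOpen U) (u : Ω → Pt K V) :
    ∃ v : Ω → Pt K V, ev K (ptPow K V Ω v) ∉ U ∧ Φ v = Φ u := by
  have : IrreducibleSpace (Pt K (pow K V Ω)) := (irreducibleSpace_def _).2 <| by
    change IsIrreducible Set.univ
    rw [← (ptPowHomeo K V Ω).range_coe, ← Set.image_univ]
    exact (IrreducibleSpace.isIrreducible_univ _).image _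
      (ptPowHomeo K V Ω).continuous.continuousOn
  have := irreducibleSpace_left K (pow K V Ω)
  obtain ⟨F, hF⟩ := h
  have hr : topologicalKrullDim (Set.range Φ) =
      topologicalKrullDim (Set.range fun a : Pt K (pow K V Ω) => a ≫ F) := by
    have : (Set.range fun a : Pt K (pow K V Ω) => a ≫ F) =
        ptPowHomeo K V Λ '' Set.range Φ := by
      rw [← Set.range_comp, ← (ptPowHomeo K V Ω).surjective.range_comp]
      exact congrArg Set.range (funext fun u => (hF u).symm)
    rw [this]
    exact ((ptPowHomeo K V Λ).image _).isHomeomorph.topologicalKrullDim_eq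
  rw [hr, (ptPowHomeo K V Ω).isHomeomorph.topologicalKrullDim_eq] at hdim
  obtain ⟨b, hb, hbF⟩ := GOE.exists_notMem_of_krullDim_range_lt K F hU hdim (ptPow K V Ω u)
  obtain ⟨v, rfl⟩ := (ptPowHomeo K V Ω).surjective b
  exact ⟨v, hb, (ptPowHomeo K V Λ).injective ((hF v).trans (hbF.trans (hF u).symm))⟩

end Regular

section Dimension

variable {K V} [IsAlgClosed K] [IsProper V.hom]

instance irreducibleSpace_cfg (Ω : Type) [Finite Ω] [IrreducibleSpace V.left] :
    IrreducibleSpace (Ω → Pt K V) := by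
  have := irreducibleSpace_pt K V
  refine (irreducibleSpace_def _).2 ?_
  simpa using isIrreducible_box (Ω := Ω)
    fun _ => IrreducibleSpace.isIrreducible_univ (Pt K V)

theorem le_topologicalKrullDim_cfg (Ω : Type) [Finite Ω] {d : ℕ}
    (hd : (d : WithBot ℕ∞) ≤ topologicalKrullDim V.left) :
    ((Nat.card Ω * d : ℕ) : WithBot ℕ∞) ≤ topologicalKrullDim (Ω → Pt K V) := by
  have := Fintype.ofFinite Ω
  rw [← topologicalKrullDim_pt K V] at hd
  obtain ⟨l, rfl⟩ := Order.le_krullDim_iff.1 hd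
  let E : (Ω → Fin (l.length + 1)) → TopologicalSpace.IrreducibleCloseds (Ω → Pt K V) := fun k =>
    { carrier := {u | ∀ i, u i ∈ l (k i)}
      isIrreducible' := isIrreducible_box fun i => (l (k i)).isIrreducible
      isClosed' := by
        simp only [Set.ofPred_forall]
        exact isClosed_iInter fun i => (l (k i)).isClosed.preimage (continuous_apply_cfg i) }
  have hE : StrictMono E := by
    intro k k' hk
    obtain ⟨hle, i, hi⟩ := Pi.lt_def.1 hk
    have hsub : E k ≤ E k' := fun u hu j => l.monotone (hle j) (hu j)
    refine lt_of_le_not_ge hsub fun hge => ?_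
    obtain ⟨a, ha, ha'⟩ := Set.exists_of_ssubset (SetLike.coe_ssubset_coe.2 (l.strictMono hi))
    choose u hu using fun j => (l (k' j)).isIrreducible.nonempty
    classical
    have := @hge (Function.update u i a) fun j => by
      by_cases h : j = i
      · subst h; simpa using ha
      · simpa [h] using hu j
    exact ha' (by simpa using this i)
  refine le_trans ?_ (Order.krullDim_le_of_strictMono E hE)
  have key : ∀ (n : ℕ) (k : Ω → Fin (l.length + 1)), ∑ i, (k i : ℕ) = n →
      (n : ℕ∞) ≤ Order.height k := by
    intro n
    induction n with
    | zero => simp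
    | succ n ih =>
      intro k hk
      obtain ⟨i, -, hi⟩ := Finset.exists_ne_zero_of_sum_ne_zero
        (show ∑ i, (k i : ℕ) ≠ 0 by lia)
      classical
      let k' := Function.update k i ⟨k i - 1, by lia⟩
      have hlt : k' < k := by
        refine Pi.lt_def.2 ⟨fun j => ?_, i, ?_⟩
        · by_cases h : j = i
          · subst h; simp [k', Fin.le_def]
          · simp [k', h]
        · simp only [k', Function.update_self, Fin.lt_def]
          lia
      have hsum : ∑ j, (k' j : ℕ) = n := by
        rw [← Finset.add_sum_erase _ _ (Finset.mem_univ i)] at hk ⊢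
        have : ∑ j ∈ Finset.univ.erase i, (k' j : ℕ) = ∑ j ∈ Finset.univ.erase i, (k j : ℕ) :=
          Finset.sum_congr rfl fun j hj => by simp [k', Finset.ne_of_mem_erase hj]
        rw [this]
        simp only [k', Function.update_self]
        lia
      exact (by exact_mod_cast add_le_add_left (ih k' hsum) 1 :
        ((n + 1 : ℕ) : ℕ∞) ≤ Order.height k' + 1).trans (Order.height_add_one_le hlt)
  have h := key _ (fun _ : Ω => Fin.last l.length) rfl
  simp only [Fin.val_last, Finset.sum_const, Finset.card_univ, smul_eq_mul,
    ← Nat.card_eq_fintype_card] at h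
  exact le_trans (by exact_mod_cast h) (Order.height_le_krullDim _)

theorem topologicalKrullDim_cfg_eq (Ω : Type) [Finite Ω] {d : ℕ}
    (hd : topologicalKrullDim V.left = d) :
    topologicalKrullDim (Ω → Pt K V) = (Nat.card Ω * d : ℕ) :=
  le_antisymm ((topologicalKrullDim_cfg Ω).trans_le (topologicalKrullDim_pow_le K V Ω hd.le))
    (le_topologicalKrullDim_cfg Ω hd.ge)

variable [IrreducibleSpace V.left]

theorem add_card_le_of_disjoint_constraints {T E Ω : Type} [Finite T] [Finite E] [Finite Ω]
    {e : T → E → Ω} (he : ∀ t t' ω ω', e t ω = e t' ω' → t = t' ∧ ω = ω')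
    {H : Set (E → Pt K V)} (hH : IsClosed H) (hne : H ≠ Set.univ) {d : ℕ}
    (hd : topologicalKrullDim V.left = d) {n : ℕ}
    (hn : (n : WithBot ℕ∞) ≤
      topologicalKrullDim {u : Ω → Pt K V | ∀ t, (fun ω => u (e t ω)) ∈ H}) :
    n + Nat.card T ≤ Nat.card Ω * d := by
  classical
  have := Fintype.ofFinite T
  set Z := {u : Ω → Pt K V | ∀ t, (fun ω => u (e t ω)) ∈ H} with hZ
  have hZc : IsClosed Z := by
    simp only [hZ, Set.ofPred_forall]
    exact isClosed_iInter fun t => hH.preimage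
      (isReg_of_isRegFun fun ω => isRegFun_apply (e t ω)).continuous
  obtain ⟨C', hC'⟩ := nat_le_krullDim_iff_exists_height.1 hn
  let C := TopologicalSpace.IrreducibleCloseds.map (Subtype.val : Z → _) continuous_subtype_val C'
  have hC : (n : ℕ∞) ≤ Order.height C := hC'.trans
    (Order.height_le_height_apply_of_strictMono _
      (TopologicalSpace.IrreducibleCloseds.map_strictMono_of_isInducing IsInducing.subtypeVal) _)
  have hCZ : (C : Set (Ω → Pt K V)) ⊆ Z :=
    hZc.closure_subset_iff.2 (by rintro _ ⟨z, -, rfl⟩; exact z.2)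
  let W : Finset T → Set Ω := fun S => {i | ∃ t ∈ S, ∃ ω, e t ω = i}
  let P : Finset T → TopologicalSpace.IrreducibleCloseds (Ω → Pt K V) := fun S =>
    { carrier := {u | ∃ c ∈ C, ∀ i ∉ W S, u i = c i}
      isIrreducible' := by
        convert isIrreducible_image2 (m := mix (V := V) (W S)) (continuous_mix_left _)
          (continuous_mix_right _) (IrreducibleSpace.isIrreducible_univ _) C.isIrreducible using 1
        ext u
        constructor
        · rintro ⟨c, hc, h⟩
          refine ⟨u, trivial, c, hc, funext fun i => ?_⟩
          by_cases hi : i ∈ W S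
          · simp [mix, hi]
          · simp [mix, hi, h i hi]
        · rintro ⟨v, -, c, hc, rfl⟩
          exact ⟨c, hc, fun i hi => by simp [mix, hi]⟩
      isClosed' := by
        have hreg : IsReg K V fun (u : Ω → Pt K V) (i : ↥(W S)ᶜ) => u i :=
          isReg_of_isRegFun fun i => isRegFun_apply i.1
        convert (hreg.isClosedMap _ C.isClosed).preimage hreg.continuous using 1
        ext u
        simp only [Set.mem_ofPred_eq, Set.mem_preimage, Set.mem_image, funext_iff, Subtype.forall,
          Set.mem_compl_iff, SetLike.mem_coe, eq_comm] }
  have hlt : ∀ (S : Finset T) (t : T), t ∉ S → P S < P (insert t S) := by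
    intro S t ht
    have hW : W S ⊆ W (insert t S) := fun i ⟨t', h, h'⟩ => ⟨t', Finset.mem_insert_of_mem h, h'⟩
    refine lt_of_le_not_ge (fun u ⟨c, hc, h⟩ => ⟨c, hc, fun i hi => h i fun h' => hi (hW h')⟩)
      fun hge => ?_
    obtain ⟨w, hw⟩ := (Set.ne_univ_iff_exists_notMem H).1 hne
    obtain ⟨c, hc⟩ := C.isIrreducible.nonempty
    have het : Function.Injective (e t) := fun ω ω' h => (he t t ω ω' h).2
    obtain ⟨c', hc', h⟩ := @hge (Function.extend (e t) w c) ⟨c, hc, fun i hi =>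
      Function.extend_apply' _ _ _ fun ⟨ω, hω⟩ => hi ⟨t, Finset.mem_insert_self _ _, ω, hω⟩⟩
    refine hw ?_
    convert hCZ hc' t using 1
    ext1 ω
    rw [← h (e t ω), het.extend_apply]
    rintro ⟨t', ht', ω', h'⟩
    exact ht ((he _ _ _ _ h').1 ▸ ht')
  have key : ∀ S : Finset T, ((n + S.card : ℕ) : ℕ∞) ≤ Order.height (P S) := by
    intro S
    induction S using Finset.induction with
    | empty =>
      exact hC.trans (Order.height_mono fun c hc => ⟨c, hc, fun _ _ => rfl⟩)
    | insert t S ht ih =>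
      rw [Finset.card_insert_of_notMem ht, ← add_assoc]
      refine le_trans ?_ (Order.height_add_one_le (hlt S t ht))
      exact_mod_cast add_le_add_left ih 1
  have h₁ : ((n + Nat.card T : ℕ) : WithBot ℕ∞) ≤ topologicalKrullDim (Ω → Pt K V) :=
    le_trans (by
      rw [Nat.card_eq_fintype_card, ← Finset.card_univ]
      exact_mod_cast key Finset.univ) (Order.height_le_krullDim (P Finset.univ))
  rw [topologicalKrullDim_cfg_eq Ω hd] at h₁
  exact_mod_cast h₁

end Dimension

section Folner

open scoped Pointwise Classical

namespace FolnerNet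

theorem eventually_card_filter_le (𝓕 : FolnerNet G) (g : G) {ε : ℝ} (hε : 0 < ε) :
    ∀ᶠ i in atTop, (((𝓕.F i).filter fun h => h * g ∉ 𝓕.F i).card : ℝ) ≤ ε * (𝓕.F i).card := by
  filter_upwards [(𝓕.folner g⁻¹).eventually_le_const hε] with i hi
  have hpos : (0 : ℝ) < (𝓕.F i).card := by exact_mod_cast (𝓕.nonempty i).card_pos
  rw [div_le_iff₀ hpos] at hi
  refine le_trans (le_of_eq (congrArg Nat.cast ?_)) hi
  rw [← Set.ncard_coe_finset]
  congr 1
  ext h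
  simp only [Finset.coe_filter, Set.mem_ofPred_eq, Set.mem_sdiff, Finset.mem_coe, Set.mem_image,
    and_congr_right_iff, not_exists, not_and]
  refine fun _ => ⟨fun h₁ x hx hxh => h₁ ?_, fun h₁ h₂ => h₁ _ h₂ (by group)⟩
  rw [← hxh]
  simpa using hx

theorem eventually_card_mul_sdiff_le (𝓕 : FolnerNet G) (M : Finset G) {ε : ℝ} (hε : 0 < ε) :
    ∀ᶠ i in atTop, ((𝓕.F i ∪ 𝓕.F i * M).card : ℝ) ≤ (1 + ε) * (𝓕.F i).card := by
  have hM : (0 : ℝ) < M.card + 1 := by positivity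
  have h := (Filter.eventually_all_finset M).2
    fun m _ => 𝓕.eventually_card_filter_le m (div_pos hε hM)
  filter_upwards [h] with i hi
  have hsub : 𝓕.F i ∪ 𝓕.F i * M ⊆
      𝓕.F i ∪ M.biUnion fun m => ((𝓕.F i).filter fun h => h * m ∉ 𝓕.F i).image (· * m) := by
    intro x hx
    by_cases hxF : x ∈ 𝓕.F i
    · exact Finset.mem_union_left _ hxF
    · obtain ⟨h, hh, m, hm, rfl⟩ := Finset.mem_mul.1 ((Finset.mem_union.1 hx).resolve_left hxF)
      exact Finset.mem_union_right _ (Finset.mem_biUnion.2 ⟨m, hm,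
        Finset.mem_image.2 ⟨h, Finset.mem_filter.2 ⟨hh, hxF⟩, rfl⟩⟩)
  have h₁ : (𝓕.F i ∪ 𝓕.F i * M).card ≤
      (𝓕.F i).card + ∑ m ∈ M, ((𝓕.F i).filter fun h => h * m ∉ 𝓕.F i).card :=
    (Finset.card_le_card hsub).trans <| (Finset.card_union_le _ _).trans <|
      Nat.add_le_add_left (Finset.card_biUnion_le.trans
        (Finset.sum_le_sum fun m _ => Finset.card_image_le)) _
  have h₂ : ∑ m ∈ M, (((𝓕.F i).filter fun h => h * m ∉ 𝓕.F i).card : ℝ) ≤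
      M.card * (ε / (M.card + 1) * (𝓕.F i).card) := by
    simpa using Finset.sum_le_card_nsmul M _ _ hi
  have h₃ : (M.card : ℝ) * (ε / (M.card + 1)) ≤ ε := by
    rw [mul_div_assoc', div_le_iff₀ hM]
    nlinarith
  calc ((𝓕.F i ∪ 𝓕.F i * M).card : ℝ)
      ≤ (𝓕.F i).card + ∑ m ∈ M, (((𝓕.F i).filter fun h => h * m ∉ 𝓕.F i).card : ℝ) := by
        exact_mod_cast h₁
    _ ≤ (𝓕.F i).card + (M.card * (ε / (M.card + 1))) * (𝓕.F i).card := by linarith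
    _ ≤ (𝓕.F i).card + ε * (𝓕.F i).card := by gcongr
    _ = _ := by ring

end FolnerNet

theorem exists_disjoint_translates (E I : Finset G) (hE : E.Nonempty) :
    ∃ T ⊆ I, (∀ t ∈ T, ∀ t' ∈ T, ∀ ω ∈ E, ∀ ω' ∈ E, t * ω = t' * ω' → t = t') ∧
      I.card ≤ T.card * E.card ^ 2 := by
  let 𝒯 := I.powerset.filter fun T =>
    ∀ t ∈ T, ∀ t' ∈ T, ∀ ω ∈ E, ∀ ω' ∈ E, t * ω = t' * ω' → t = t'
  obtain ⟨T, hT, hmax⟩ := Finset.exists_max_image 𝒯 Finset.card ⟨∅, by simp [𝒯]⟩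
  simp only [𝒯, Finset.mem_filter, Finset.mem_powerset] at hT hmax
  refine ⟨T, hT.1, hT.2, ?_⟩
  have hsub : I ⊆ T * E * E⁻¹ := by
    intro g hg
    have key : ∃ t ∈ T, ∃ ω ∈ E, ∃ ω' ∈ E, g * ω = t * ω' := by
      by_contra! hcon
      have hgT : g ∉ T := fun h => by
        obtain ⟨ω, hω⟩ := hE
        exact hcon g h ω hω ω hω rfl
      have := hmax (insert g T) ⟨Finset.insert_subset hg hT.1, ?_⟩
      · rw [Finset.card_insert_of_notMem hgT] at this
        lia
      · intro t ht t' ht' ω hω ω' hω' h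
        rcases Finset.mem_insert.1 ht with h₁ | h₁ <;>
          rcases Finset.mem_insert.1 ht' with h₂ | h₂
        · exact h₁.trans h₂.symm
        · exact absurd (h₁ ▸ h) (hcon _ h₂ _ hω _ hω')
        · exact absurd (h₂ ▸ h.symm) (hcon _ h₁ _ hω' _ hω)
        · exact hT.2 _ h₁ _ h₂ _ hω _ hω' h
    obtain ⟨t, ht, ω, hω, ω', hω', h⟩ := key
    rw [eq_mul_inv_of_mul_eq h]
    exact Finset.mul_mem_mul (Finset.mul_mem_mul ht hω') (Finset.inv_mem_inv hω)
  calc I.card ≤ (T * E * E⁻¹).card := Finset.card_le_card hsub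
    _ ≤ (T * E).card * E⁻¹.card := Finset.card_mul_le
    _ ≤ T.card * E.card * E.card := by
      rw [Finset.card_inv]
      exact Nat.mul_le_mul_right _ Finset.card_mul_le
    _ = _ := by ring

theorem FolnerNet.eventually_exists_translates (𝓕 : FolnerNet G) {E : Finset G}
    (hE : E.Nonempty) : ∀ᶠ i in atTop, ∃ T : Finset G, (∀ t ∈ T, ∀ ω ∈ E, t * ω ∈ 𝓕.F i) ∧
      (∀ t ∈ T, ∀ t' ∈ T, ∀ ω ∈ E, ∀ ω' ∈ E, t * ω = t' * ω' → t = t') ∧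
      ((𝓕.F i).card : ℝ) ≤ 2 * (E.card : ℝ) ^ 2 * T.card := by
  obtain ⟨ω₀, hω₀⟩ := hE
  have hE0 : (0 : ℝ) < E.card := by exact_mod_cast Finset.card_pos.2 ⟨ω₀, hω₀⟩
  have h := (Filter.eventually_all_finset E).2
    fun ω _ => 𝓕.eventually_card_filter_le (ω₀⁻¹ * ω) (ε := 1 / (2 * E.card)) (by positivity)
  filter_upwards [h] with i hi
  let I' := (𝓕.F i).filter fun h => ∀ ω ∈ E, h * (ω₀⁻¹ * ω) ∈ 𝓕.F i
  obtain ⟨T, hTI, hT, hcard⟩ := exists_disjoint_translates E (I'.image (· * ω₀⁻¹)) ⟨ω₀, hω₀⟩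
  refine ⟨T, fun t ht ω hω => ?_, hT, ?_⟩
  · obtain ⟨h, hh, rfl⟩ := Finset.mem_image.1 (hTI ht)
    rw [mul_assoc]
    exact (Finset.mem_filter.1 hh).2 ω hω
  · rw [Finset.card_image_of_injective _ (mul_left_injective _)] at hcard
    have hsub : 𝓕.F i ⊆ I' ∪
        E.biUnion fun ω => (𝓕.F i).filter fun h => h * (ω₀⁻¹ * ω) ∉ 𝓕.F i := by
      intro x hx
      simp only [I', Finset.mem_union, Finset.mem_filter, Finset.mem_biUnion]
      by_cases hx' : ∀ ω ∈ E, x * (ω₀⁻¹ * ω) ∈ 𝓕.F i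
      · exact .inl ⟨hx, hx'⟩
      · push Not at hx'
        obtain ⟨ω, hω, hxω⟩ := hx'
        exact .inr ⟨ω, hω, hx, hxω⟩
    have h₁ : (𝓕.F i).card ≤ I'.card +
        ∑ ω ∈ E, ((𝓕.F i).filter fun h => h * (ω₀⁻¹ * ω) ∉ 𝓕.F i).card :=
      (Finset.card_le_card hsub).trans <| (Finset.card_union_le _ _).trans <|
        Nat.add_le_add_left Finset.card_biUnion_le _
    have h₂ : ∑ ω ∈ E, (((𝓕.F i).filter fun h => h * (ω₀⁻¹ * ω) ∉ 𝓕.F i).card : ℝ) ≤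
        E.card * (1 / (2 * E.card) * (𝓕.F i).card) := by
      simpa using Finset.sum_le_card_nsmul E _ _ hi
    have h₃ : (E.card : ℝ) * (1 / (2 * E.card) * (𝓕.F i).card) = (𝓕.F i).card / 2 := by
      field_simp
    have h₄ : ((𝓕.F i).card : ℝ) ≤ I'.card +
        ∑ ω ∈ E, (((𝓕.F i).filter fun h => h * (ω₀⁻¹ * ω) ∉ 𝓕.F i).card : ℝ) := by
      exact_mod_cast h₁
    have h₅ : (I'.card : ℝ) ≤ T.card * (E.card : ℝ) ^ 2 := by exact_mod_cast hcard
    nlinarith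

theorem FolnerNet.exists_eventually_translates (𝓕 : FolnerNet G) {E : Finset G}
    (hE : E.Nonempty) (M : Finset G) (d : ℕ) : ∃ β : ℝ, 0 < β ∧ ∀ᶠ i in atTop,
      ∃ T : Finset G, (∀ t ∈ T, ∀ ω ∈ E, t * ω ∈ 𝓕.F i) ∧
      (∀ t ∈ T, ∀ t' ∈ T, ∀ ω ∈ E, ∀ ω' ∈ E, t * ω = t' * ω' → t = t') ∧
      ((𝓕.F i ∪ 𝓕.F i * M).card : ℝ) * d + β * (𝓕.F i).card ≤ (𝓕.F i).card * d + T.card := by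
  have hE0 : (0 : ℝ) < E.card := by exact_mod_cast Finset.card_pos.2 hE
  set c : ℝ := 1 / (2 * (E.card : ℝ) ^ 2) with hc
  have hc0 : 0 < c := by positivity
  refine ⟨c / 2, by positivity, ?_⟩
  filter_upwards [𝓕.eventually_exists_translates hE,
    𝓕.eventually_card_mul_sdiff_le M (ε := c / (2 * (d + 1))) (by positivity)] with i hT hM
  obtain ⟨T, h₁, h₂, h₃⟩ := hT
  refine ⟨T, h₁, h₂, ?_⟩
  have h₄ : c * (𝓕.F i).card ≤ T.card := by
    rw [hc, one_div, inv_mul_le_iff₀ (by positivity)]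
    exact h₃
  have h₅ : c / (2 * (d + 1)) * d ≤ c / 2 := by
    rw [div_mul_eq_mul_div, div_le_div_iff₀ (by positivity) (by positivity)]
    nlinarith
  have h₆ : (0 : ℝ) ≤ (𝓕.F i).card := by positivity
  calc ((𝓕.F i ∪ 𝓕.F i * M).card : ℝ) * d + c / 2 * (𝓕.F i).card
      ≤ ((1 + c / (2 * (d + 1))) * (𝓕.F i).card) * d + c / 2 * (𝓕.F i).card := by gcongr
    _ = (𝓕.F i).card * d + (c / (2 * (d + 1)) * d) * (𝓕.F i).card + c / 2 * (𝓕.F i).card := by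
      ring
    _ ≤ (𝓕.F i).card * d + (c / 2) * (𝓕.F i).card + c / 2 * (𝓕.F i).card := by gcongr
    _ ≤ _ := by linarith

end Folner

section MeanDimension

theorem dimE_natCast (n : ℕ) : dimE (n : WithBot ℕ∞) = ((n : ℝ) : EReal) := by
  change (((n : ℕ∞) : ℝ≥0∞) : EReal) = _
  rw [ENat.toENNReal_coe, ← ENNReal.coe_natCast, EReal.coe_nnreal_eq_coe_real, NNReal.coe_natCast]

variable {K V}

theorem mdim_eq_of_forall {𝓕 : FolnerNet G} {Γ : Set (G → Pt K V)} {d : ℕ}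
    (h : ∀ F : Finset G, cfgDim K V F (restr K V Γ F) = (F.card * d : ℕ)) :
    mdim K V 𝓕 Γ = dimE d := by
  have : ∀ i, dimE (cfgDim K V ↥(𝓕.F i) (restr K V Γ (𝓕.F i))) *
      ((((𝓕.F i).card : ℝ)⁻¹ : ℝ) : EReal) = dimE d := fun i => by
    have hpos : (0 : ℝ) < (𝓕.F i).card := by exact_mod_cast (𝓕.nonempty i).card_pos
    rw [h, dimE_natCast, dimE_natCast, ← EReal.coe_mul]
    congr 1
    push_cast
    field_simp
  rw [mdim]
  simp only [this]
  exact limsup_const _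

theorem mdim_lt_of_eventually {𝓕 : FolnerNet G} {Γ : Set (G → Pt K V)} {d : ℕ} {β : ℝ}
    (hβ : 0 < β) (h : ∀ᶠ i in atTop, ∀ n : ℕ,
      (n : WithBot ℕ∞) ≤ cfgDim K V ↥(𝓕.F i) (restr K V Γ (𝓕.F i)) →
        (n : ℝ) ≤ (d - β) * (𝓕.F i).card) :
    mdim K V 𝓕 Γ < dimE d := by
  have hle : mdim K V 𝓕 Γ ≤ ((d - β : ℝ) : EReal) := by
    refine limsup_le_of_le (h := ?_)
    filter_upwards [h] with i hi
    have hpos : (0 : ℝ) < (𝓕.F i).card := by exact_mod_cast (𝓕.nonempty i).card_pos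
    generalize cfgDim K V ↥(𝓕.F i) (restr K V Γ (𝓕.F i)) = D at hi
    induction D using WithBot.recBotCoe with
    | bot =>
      change ⊥ * _ ≤ _
      rw [EReal.bot_mul_coe_of_pos (inv_pos.2 hpos)]
      exact bot_le
    | coe D =>
      induction D using ENat.recTopCoe with
      | top =>
        obtain ⟨n, hn⟩ := exists_nat_gt ((d - β) * (𝓕.F i).card)
        exact absurd (hi n (WithBot.coe_le_coe.2 le_top)) hn.not_ge
      | coe n =>
        change dimE (n : WithBot ℕ∞) * _ ≤ _
        rw [dimE_natCast, ← EReal.coe_mul, EReal.coe_le_coe_iff, ← div_eq_mul_inv,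
          div_le_iff₀ hpos]
        exact hi n le_rfl
  refine hle.trans_lt ?_
  rw [dimE_natCast, EReal.coe_lt_coe_iff]
  linarith

end MeanDimension

section Dynamics

open scoped Pointwise Classical

variable {K V}

/-- Glue a pattern on `Ω` with a configuration on the complement of `Ω`. -/
def glue {G : Type} (Ω : Finset G) (u : ↥Ω → Pt K V) (p : {g : G // g ∉ Ω} → Pt K V) : G → Pt K V :=
  fun g => if h : g ∈ Ω then u ⟨g, h⟩ else p ⟨g, h⟩

theorem glue_of_mem {G : Type} {Ω : Finset G} (u : ↥Ω → Pt K V) (p : {g : G // g ∉ Ω} → Pt K V) {g : G}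
    (h : g ∈ Ω) : glue Ω u p g = u ⟨g, h⟩ := dif_pos h

theorem glue_of_notMem {G : Type} {Ω : Finset G} (u : ↥Ω → Pt K V) (p : {g : G // g ∉ Ω} → Pt K V) {g : G}
    (h : g ∉ Ω) : glue Ω u p g = p ⟨g, h⟩ := dif_neg h

theorem restrict_glue {G : Type} {Ω : Finset G} (u : ↥Ω → Pt K V) (p : {g : G // g ∉ Ω} → Pt K V) :
    (fun ω : ↥Ω => glue Ω u p ω) = u :=
  funext fun ω => glue_of_mem u p ω.2

theorem glue_mem_cyl {G : Type} {Ω : Finset G} {D : Set (↥Ω → Pt K V)} {u : ↥Ω → Pt K V} (hu : u ∈ D)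
    (p : {g : G // g ∉ Ω} → Pt K V) : glue Ω u p ∈ cyl K V Ω D p :=
  ⟨by rwa [restrict_glue], fun _ h => glue_of_notMem u p h⟩

theorem eq_glue_of_mem_cyl {G : Type} {Ω : Finset G} {D : Set (↥Ω → Pt K V)} {x : G → Pt K V}
    {p : {g : G // g ∉ Ω} → Pt K V} (hx : x ∈ cyl K V Ω D p) :
    x = glue Ω (fun ω => x ω) p := by
  ext1 g
  by_cases h : g ∈ Ω
  · rw [glue_of_mem _ _ h]
  · rw [glue_of_notMem _ _ h, hx.2 g h]

variable {τ : (G → Pt K V) → (G → Pt K V)} {M : Finset G} {f : pow K V ↥M ⟶ V}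

theorem localMap_congr
    (hτ : ∀ x g, τ x g = ptPow K V ↥M (fun m => x (g * (m : G))) ≫ f)
    {x y : G → Pt K V} {g : G} (h : ∀ m ∈ M, x (g * m) = y (g * m)) : τ x g = τ y g := by
  rw [hτ, hτ, show (fun m : ↥M => x (g * (m : G))) = fun m : ↥M => y (g * (m : G)) from
    funext fun m => h m m.2]

theorem localMap_translate
    (hτ : ∀ x g, τ x g = ptPow K V ↥M (fun m => x (g * (m : G))) ≫ f)
    (x : G → Pt K V) (t g : G) : τ (fun h => x (t * h)) g = τ x (t * g) := by
  simp only [hτ, mul_assoc]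

theorem isReg_localMap
    (hτ : ∀ x g, τ x g = ptPow K V ↥M (fun m => x (g * (m : G))) ≫ f)
    (Ω Λ : Finset G) (p : {g : G // g ∉ Ω} → Pt K V) :
    IsReg K V fun (u : ↥Ω → Pt K V) (l : ↥Λ) => τ (glue Ω u p) l := by
  refine isReg_of_isRegFun fun l => ?_
  simp only [hτ]
  refine IsRegFun.comp f fun m => ?_
  by_cases h : (l : G) * m ∈ Ω
  · simp only [glue_of_mem _ _ h]
    exact isRegFun_apply _
  · simp only [glue_of_notMem _ _ h]
    exact isRegFun_const _

theorem restr_range_eq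
    (hτ : ∀ x g, τ x g = ptPow K V ↥M (fun m => x (g * (m : G))) ≫ f)
    {Ω E : Finset G} (h : E * M ⊆ Ω) (p : {g : G // g ∉ Ω} → Pt K V) :
    restr K V (Set.range τ) E = Set.range fun (u : ↥Ω → Pt K V) (l : ↥E) => τ (glue Ω u p) l := by
  ext w
  constructor
  · rintro ⟨_, ⟨x, rfl⟩, rfl⟩
    refine ⟨fun ω => x ω, funext fun l => localMap_congr hτ fun m hm => ?_⟩
    rw [glue_of_mem _ _ (h (Finset.mul_mem_mul l.2 hm))]
  · rintro ⟨u, rfl⟩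
    exact ⟨_, ⟨_, rfl⟩, rfl⟩

theorem translate_mem_restr_range
    (hτ : ∀ x g, τ x g = ptPow K V ↥M (fun m => x (g * (m : G))) ≫ f)
    (E : Finset G) (x : G → Pt K V) (t : G) :
    (fun ω : ↥E => τ x (t * ω)) ∈ restr K V (Set.range τ) E :=
  ⟨_, ⟨fun h => x (t * h), rfl⟩, funext fun ω => localMap_translate hτ x t ω⟩

variable [IsAlgClosed K] [IsProper V.hom] [Nonempty (Pt K V)]

theorem isClosed_restr_range
    (hτ : ∀ x g, τ x g = ptPow K V ↥M (fun m => x (g * (m : G))) ≫ f)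
    (E : Finset G) : IsClosed (restr K V (Set.range τ) E) := by
  rw [restr_range_eq hτ subset_rfl fun _ => Classical.arbitrary _]
  exact (isReg_localMap hτ _ _ _).isClosedMap.isClosed_range

theorem exists_restr_range_ne_univ
    (hτ : ∀ x g, τ x g = ptPow K V ↥M (fun m => x (g * (m : G))) ≫ f)
    (hsurj : ¬ Function.Surjective τ) :
    ∃ E : Finset G, restr K V (Set.range τ) E ≠ Set.univ := by
  by_contra! hcon
  refine hsurj fun c => ?_
  let Good : Set (Set (G × Pt K V)) := {Γ | ∀ (E : Finset G) (Δ : Finset (G × Pt K V)), ↑Δ ⊆ Γ →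
    ∃ x : G → Pt K V, (∀ q ∈ Δ, x q.1 = q.2) ∧ ∀ g ∈ E, τ x g = c g}
  have h0 : ∅ ∈ Good := by
    intro E Δ hΔ
    obtain ⟨_, ⟨x, rfl⟩, hx⟩ : (fun g : ↥E => c g) ∈ restr K V (Set.range τ) E :=
      hcon E ▸ trivial
    refine ⟨x, fun q hq => (hΔ hq).elim, fun g hg => congrFun hx ⟨g, hg⟩⟩
  obtain ⟨Γ, -, hΓ⟩ := zorn_subset_nonempty Good (fun C hC hchain hne => by
    refine ⟨⋃₀ C, fun E Δ hΔ => ?_, fun s hs => Set.subset_sUnion_of_mem hs⟩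
    obtain ⟨s, hs, hΔs⟩ := hchain.directedOn.exists_mem_subset_of_finset_subset_biUnion
      hne (by simpa [Set.sUnion_eq_biUnion] using hΔ)
    exact hC hs E Δ hΔs) ∅ h0
  have hex : ∀ g : G, ∃ a : Pt K V, (g, a) ∈ Γ := by
    intro g
    let ι := Finset G × {Δ : Finset (G × Pt K V) // (Δ : Set (G × Pt K V)) ⊆ Γ}
    let B : ι → Set (Pt K V) := fun i => {a | ∃ x : G → Pt K V, (∀ q ∈ i.2.1, x q.1 = q.2) ∧
      (∀ g ∈ i.1, τ x g = c g) ∧ x g = a}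
    have hBc : ∀ i, IsClosed (B i) := by
      rintro ⟨E, Δ, hΔ⟩
      let Ω : Finset G := insert g (E * M ∪ Δ.image Prod.fst)
      let p : {g : G // g ∉ Ω} → Pt K V := fun _ => Classical.arbitrary _
      let S : Set (↥Ω → Pt K V) := {u | (∀ q ∈ Δ, glue Ω u p q.1 = q.2) ∧
        (fun l : ↥E => τ (glue Ω u p) l) = fun l : ↥E => c l}
      have hgΩ : g ∈ Ω := Finset.mem_insert_self _ _
      have hq : ∀ q ∈ Δ, q.1 ∈ Ω := fun q hq => Finset.mem_insert_of_mem
        (Finset.mem_union_right _ (Finset.mem_image_of_mem _ hq))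
      have hS : IsClosed S := by
        refine IsClosed.inter ?_ ?_
        · have : {u : ↥Ω → Pt K V | ∀ q ∈ Δ, glue Ω u p q.1 = q.2} =
              ⋂ q : ↥Δ, (fun u : ↥Ω → Pt K V => u ⟨q.1.1, hq q.1 q.2⟩) ⁻¹' {q.1.2} := by
            ext u
            simp only [Set.mem_ofPred_eq, Set.mem_iInter, Set.mem_preimage, Set.mem_singleton_iff]
            exact ⟨fun h q => (glue_of_mem u p _).symm.trans (h q.1 q.2),
              fun h q hqΔ => (glue_of_mem u p (hq q hqΔ)).trans (h ⟨q, hqΔ⟩)⟩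
          change IsClosed {u : ↥Ω → Pt K V | ∀ q ∈ Δ, glue Ω u p q.1 = q.2}
          rw [this]
          have := t1Space_pt K V
          exact isClosed_iInter fun q => isClosed_singleton.preimage (continuous_apply_cfg _)
        · exact isClosed_singleton.preimage (isReg_localMap hτ Ω E p).continuous
      convert isClosedMap_apply_cfg (⟨g, hgΩ⟩ : ↥Ω) S hS using 1
      ext a
      constructor
      · rintro ⟨x, hx, hxE, rfl⟩
        refine ⟨fun ω => x ω, ⟨fun q hqΔ => ?_, funext fun l => ?_⟩, rfl⟩
        · rw [glue_of_mem _ _ (hq q hqΔ), hx q hqΔ]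
        · rw [← hxE l l.2]
          refine localMap_congr hτ fun m hm => glue_of_mem _ _ ?_
          exact Finset.mem_insert_of_mem (Finset.mem_union_left _ (Finset.mul_mem_mul l.2 hm))
      · rintro ⟨u, ⟨hu, huE⟩, rfl⟩
        exact ⟨glue Ω u p, hu, fun h hh => congrFun huE ⟨h, hh⟩, glue_of_mem _ _ hgΩ⟩
    have := noetherianSpace_pt K V
    have : Nonempty ι := ⟨(∅, ⟨∅, by simp⟩)⟩
    obtain ⟨a, ha⟩ := IsCompact.nonempty_iInter_of_directed_nonempty_isCompact_isClosed B
      (fun i j => ⟨((i.1 ∪ j.1, ⟨i.2.1 ∪ j.2.1, by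
        rw [Finset.coe_union]; exact Set.union_subset i.2.2 j.2.2⟩) : ι),
        fun a ⟨x, h₁, h₂, h₃⟩ => ⟨x, fun q hq => h₁ q (Finset.mem_union_left _ hq),
          fun q hq => h₂ q (Finset.mem_union_left _ hq), h₃⟩,
        fun a ⟨x, h₁, h₂, h₃⟩ => ⟨x, fun q hq => h₁ q (Finset.mem_union_right _ hq),
          fun q hq => h₂ q (Finset.mem_union_right _ hq), h₃⟩⟩)
      (fun i => by
        obtain ⟨x, h₁, h₂⟩ := hΓ.prop i.1 i.2.1 i.2.2
        exact ⟨x g, x, h₁, h₂, rfl⟩)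
      (fun i => (hBc i).isCompact) hBc
    rw [Set.mem_iInter] at ha
    refine ⟨a, hΓ.le_of_ge (y := insert (g, a) Γ) (fun E Δ hΔ => ?_) (Set.subset_insert _ _)
      (Set.mem_insert _ _)⟩
    obtain ⟨x, h₁, h₂, h₃⟩ := ha (E, ⟨Δ.erase (g, a), by
      rw [Finset.coe_erase]
      exact Set.sdiff_singleton_subset_iff.2 hΔ⟩)
    refine ⟨x, fun q hq => ?_, h₂⟩
    by_cases h : q = (g, a)
    · subst h; exact h₃
    · exact h₁ q (Finset.mem_erase.2 ⟨h, hq⟩)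
  choose x hx using hex
  refine ⟨x, funext fun g => ?_⟩
  obtain ⟨y, hy, hyc⟩ := hΓ.prop {g} (M.image fun m => (g * m, x (g * m))) (by
    intro q hq
    obtain ⟨m, -, rfl⟩ := Finset.mem_image.1 hq
    exact hx _)
  rw [← hyc g (Finset.mem_singleton_self g)]
  exact localMap_congr hτ fun m hm => (hy _ (Finset.mem_image_of_mem _ hm)).symm

end Dynamics

section GardenOfEden

open scoped Pointwise Classical

variable {K V} {τ : (G → Pt K V) → (G → Pt K V)} {M : Finset G} {f : pow K V ↥M ⟶ V}

theorem image_cyl_univ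
    (hτ : ∀ x g, τ x g = ptPow K V ↥M (fun m => x (g * (m : G))) ≫ f)
    {Ω Λ : Finset G} (hΛ : ∀ g ∉ Λ, ∀ m ∈ M, g * m ∉ Ω) (u₀ : ↥Ω → Pt K V)
    (p : {g : G // g ∉ Ω} → Pt K V) :
    τ '' cyl K V Ω Set.univ p =
      cyl K V Λ (Set.range fun (u : ↥Ω → Pt K V) (l : ↥Λ) => τ (glue Ω u p) l)
        fun g => τ (glue Ω u₀ p) g := by
  have hoff : ∀ u v : ↥Ω → Pt K V, ∀ g ∉ Λ, τ (glue Ω u p) g = τ (glue Ω v p) g :=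
    fun u v g hg => localMap_congr hτ fun m hm => by
      rw [glue_of_notMem _ _ (hΛ g hg m hm), glue_of_notMem _ _ (hΛ g hg m hm)]
  ext c
  constructor
  · rintro ⟨x, hx, rfl⟩
    rw [eq_glue_of_mem_cyl hx]
    exact ⟨⟨_, rfl⟩, fun g hg => hoff _ _ g hg⟩
  · rintro ⟨⟨u, hu⟩, hc⟩
    refine ⟨glue Ω u p, glue_mem_cyl (Set.mem_univ _) p, funext fun g => ?_⟩
    by_cases hg : g ∈ Λ
    · exact congrFun hu ⟨g, hg⟩
    · exact (hoff u u₀ g hg).trans (hc g hg).symm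

theorem exists_forall_translate_mem
    (hτ : ∀ x g, τ x g = ptPow K V ↥M (fun m => x (g * (m : G))) ≫ f)
    {Ω : Finset G} {H : Set (↥Ω → Pt K V)}
    (h : ∀ p : {g : G // g ∉ Ω} → Pt K V, τ '' cyl K V Ω Set.univ p = τ '' cyl K V Ω H p)
    (T : Finset G)
    (hT : ∀ t ∈ T, ∀ t' ∈ T, ∀ ω ∈ Ω, ∀ ω' ∈ Ω, t * ω = t' * ω' → t = t') (x : G → Pt K V) :
    ∃ y, τ y = τ x ∧ ∀ t ∈ T, (fun ω : ↥Ω => y (t * ω)) ∈ H := by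
  induction T using Finset.induction_on with
  | empty => exact ⟨x, rfl, by simp⟩
  | insert t S ht ih =>
    obtain ⟨y, hy, hyS⟩ := ih fun a ha b hb =>
      hT a (Finset.mem_insert_of_mem ha) b (Finset.mem_insert_of_mem hb)
    obtain ⟨z, hz, hzy⟩ : τ (fun g => y (t * g)) ∈ τ '' cyl K V Ω H fun g => y (t * g) :=
      h _ ▸ ⟨_, ⟨Set.mem_univ _, fun _ _ => rfl⟩, rfl⟩
    refine ⟨fun g => z (t⁻¹ * g), ?_, fun a ha => ?_⟩
    · ext1 g
      rw [localMap_translate hτ, hzy, localMap_translate hτ, mul_inv_cancel_left, hy]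
    · obtain rfl | ha := Finset.mem_insert.1 ha
      · simpa using hz.1
      · convert hyS a ha using 2 with ω
        have hnot : t⁻¹ * (a * ω) ∉ Ω := fun hω => ht <| by
          rwa [hT t (Finset.mem_insert_self _ _) a (Finset.mem_insert_of_mem ha) _ hω ω ω.2
            (mul_inv_cancel_left _ _)]
        refine (hz.2 _ hnot).trans ?_
        simp only [mul_inv_cancel_left]

theorem starPreInjective_of_preInjective {G : Type} {τ : (G → Pt K V) → (G → Pt K V)}
    [Nonempty (Pt K V)] (h : PreInjective K V τ) :
    StarPreInjective K V τ := by
  rintro ⟨Ω, H, -, hne, heq⟩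
  obtain ⟨u, hu⟩ := (Set.ne_univ_iff_exists_notMem H).1 hne
  let p : {g : G // g ∉ Ω} → Pt K V := fun _ => Classical.arbitrary _
  obtain ⟨y, hy, hyu⟩ : τ (glue Ω u p) ∈ τ '' cyl K V Ω H p :=
    heq p ▸ ⟨_, glue_mem_cyl (Set.mem_univ _) p, rfl⟩
  refine hu ?_
  have : y = glue Ω u p := h _ _ (Ω.finite_toSet.subset fun g hg => by
    by_contra hgΩ
    exact hg ((hy.2 g hgΩ).trans (glue_of_notMem u p hgΩ).symm)) hyu
  rw [← restrict_glue u p, ← this]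
  exact hy.1

variable [IsAlgClosed K] [IsProper V.hom]

theorem cfgDim_univ {G : Type} (Ω : Finset G) {d : ℕ} (hd : topologicalKrullDim V.left = d) :
    cfgDim K V ↥Ω Set.univ = (Ω.card * d : ℕ) := by
  refine ((Homeomorph.Set.univ (↥Ω → Pt K V)).isHomeomorph.topologicalKrullDim_eq).trans ?_
  rw [topologicalKrullDim_cfg_eq _ hd, Nat.card_eq_finsetCard]

theorem mdim_range_of_surjective [Nonempty (Pt K V)] (𝓕 : FolnerNet G) {d : ℕ}
    (hd : topologicalKrullDim V.left = d) (h : Function.Surjective τ) : mdim K V 𝓕 (Set.range τ) = dimE d := by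
  refine mdim_eq_of_forall fun F => ?_
  rw [← cfgDim_univ F hd, h.range_eq]
  congr 1
  exact Set.eq_univ_of_forall fun u =>
    ⟨glue F u fun _ => Classical.arbitrary _, trivial, restrict_glue _ _⟩

variable [IrreducibleSpace V.left]

theorem add_card_le_of_translates {T E Λ : Finset G} (hTΛ : ∀ t ∈ T, ∀ ω ∈ E, t * ω ∈ Λ)
    (hT : ∀ t ∈ T, ∀ t' ∈ T, ∀ ω ∈ E, ∀ ω' ∈ E, t * ω = t' * ω' → t = t')
    {H : Set (↥E → Pt K V)} (hH : IsClosed H) (hne : H ≠ Set.univ) {d : ℕ}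
    (hd : topologicalKrullDim V.left = d) {n : ℕ}
    (hn : (n : WithBot ℕ∞) ≤ topologicalKrullDim
      {u : ↥Λ → Pt K V | ∀ t : ↥T, (fun ω : ↥E => u ⟨t * ω, hTΛ t t.2 ω ω.2⟩) ∈ H}) :
    n + T.card ≤ Λ.card * d := by
  have := add_card_le_of_disjoint_constraints
    (e := fun (t : ↥T) (ω : ↥E) => (⟨t * ω, hTΛ t t.2 ω ω.2⟩ : ↥Λ)) (fun t t' ω ω' h => by
      have h : (t : G) * ω = t' * ω' := congrArg Subtype.val h
      obtain rfl := Subtype.ext (hT t t.2 t' t'.2 ω ω.2 ω' ω'.2 h)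
      exact ⟨rfl, Subtype.ext (mul_left_cancel h)⟩) hH hne hd hn
  simpa only [Nat.card_eq_finsetCard] using this

variable [Nonempty (Pt K V)] {d : ℕ}

theorem surjective_of_starStarPreInjective (𝓕 : FolnerNet G)
    (hτ : ∀ x g, τ x g = ptPow K V ↥M (fun m => x (g * (m : G))) ≫ f)
    (hd : topologicalKrullDim V.left = d) (h : StarStarPreInjective K V τ) :
    Function.Surjective τ := by
  by_contra hs
  obtain ⟨E, hne⟩ := exists_restr_range_ne_univ hτ hs
  have hE : E.Nonempty := by
    rw [Finset.nonempty_iff_ne_empty]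
    rintro rfl
    refine hne (Set.eq_univ_of_forall fun w => ?_)
    exact ⟨_, ⟨fun _ => Classical.arbitrary _, rfl⟩, Subsingleton.elim _ _⟩
  obtain ⟨β, hβ, hev⟩ := 𝓕.exists_eventually_translates hE M⁻¹ d
  obtain ⟨i, T, hTF, hT, hcard⟩ := hev.exists
  refine h ⟨𝓕.F i, fun p => ⟨𝓕.F i ∪ 𝓕.F i * M⁻¹, _, _,
    image_cyl_univ hτ (fun g hg m hm hgm => hg ?_) (fun _ => Classical.arbitrary _) p, ?_⟩⟩
  · refine Finset.mem_union_right _ ?_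
    simpa using Finset.mul_mem_mul hgm (Finset.inv_mem_inv hm)
  · rw [cfgDim_univ _ hd]
    by_contra! hle
    have hn := add_card_le_of_translates (fun t ht ω hω => Finset.mem_union_left _ (hTF t ht ω hω))
      hT (isClosed_restr_range hτ E) hne hd (hle.trans (topologicalKrullDim_mono ?_))
    · have hpos : (0 : ℝ) < (𝓕.F i).card := by exact_mod_cast (𝓕.nonempty i).card_pos
      have hn' : ((𝓕.F i).card * d + T.card : ℝ) ≤ (𝓕.F i ∪ 𝓕.F i * M⁻¹).card * d := by
        exact_mod_cast hn
      nlinarith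
    · rintro _ ⟨u, rfl⟩ t
      exact translate_mem_restr_range hτ E _ _

theorem mdim_range_lt (𝓕 : FolnerNet G)
    (hτ : ∀ x g, τ x g = ptPow K V ↥M (fun m => x (g * (m : G))) ≫ f)
    (hd : topologicalKrullDim V.left = d) {Ω : Finset G} {H : Set (↥Ω → Pt K V)}
    (hH : IsClosed H) (hne : H ≠ Set.univ)
    (h : ∀ p : {g : G // g ∉ Ω} → Pt K V, τ '' cyl K V Ω Set.univ p = τ '' cyl K V Ω H p) :
    mdim K V 𝓕 (Set.range τ) < dimE d := by
  have hΩ : Ω.Nonempty := by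
    rw [Finset.nonempty_iff_ne_empty]
    rintro rfl
    have p : {g : G // g ∉ (∅ : Finset G)} → Pt K V := fun _ => Classical.arbitrary _
    obtain ⟨y, hy, -⟩ : τ (glue ∅ (fun _ => Classical.arbitrary _) p) ∈ τ '' cyl K V ∅ H p :=
      h p ▸ ⟨_, glue_mem_cyl (Set.mem_univ _) p, rfl⟩
    exact hne (Set.eq_univ_of_forall fun w => Subsingleton.elim (_ : _) w ▸ hy.1)
  obtain ⟨β, hβ, hev⟩ := 𝓕.exists_eventually_translates hΩ M d
  refine mdim_lt_of_eventually hβ ?_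
  filter_upwards [hev] with i ⟨T, hTF, hT, hcard⟩ n hn
  have hTΛ : ∀ t ∈ T, ∀ ω ∈ Ω, t * ω ∈ 𝓕.F i ∪ 𝓕.F i * M :=
    fun t ht ω hω => Finset.mem_union_left _ (hTF t ht ω hω)
  let p : {g : G // g ∉ 𝓕.F i ∪ 𝓕.F i * M} → Pt K V := fun _ => Classical.arbitrary _
  have hΦ := isReg_localMap hτ (𝓕.F i ∪ 𝓕.F i * M) (𝓕.F i) p
  have hsub : restr K V (Set.range τ) (𝓕.F i) ⊆
      (fun (u : ↥(𝓕.F i ∪ 𝓕.F i * M) → Pt K V) (l : ↥(𝓕.F i)) =>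
        τ (glue (𝓕.F i ∪ 𝓕.F i * M) u p) l) ''
      {u | ∀ t : ↥T, (fun ω : ↥Ω => u ⟨t * ω, hTΛ t t.2 ω ω.2⟩) ∈ H} := by
    rintro _ ⟨_, ⟨x, rfl⟩, rfl⟩
    obtain ⟨y, hy, hyT⟩ := exists_forall_translate_mem hτ h T hT x
    refine ⟨fun ω => y ω, fun t => hyT t t.2, funext fun l => ?_⟩
    rw [← hy]
    refine localMap_congr hτ fun m hm => glue_of_mem _ _ ?_
    exact Finset.mem_union_right _ (Finset.mul_mem_mul l.2 hm)
  have hZ : IsClosed {u : ↥(𝓕.F i ∪ 𝓕.F i * M) → Pt K V |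
      ∀ t : ↥T, (fun ω : ↥Ω => u ⟨t * ω, hTΛ t t.2 ω ω.2⟩) ∈ H} := by
    simp only [Set.ofPred_forall]
    exact isClosed_iInter fun t => hH.preimage
      (isReg_of_isRegFun fun ω : ↥Ω => isRegFun_apply _).continuous
  have hle := add_card_le_of_translates hTΛ hT hH hne hd <| hn.trans <|
    (topologicalKrullDim_mono hsub).trans
      (topologicalKrullDim_image_le hΦ.continuous hΦ.isClosedMap hZ)
  have hle' : (n + T.card : ℝ) ≤ (𝓕.F i ∪ 𝓕.F i * M).card * d := by exact_mod_cast hle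
  linarith

theorem starStarPreInjective_of_starPreInjective
    (hτ : ∀ x g, τ x g = ptPow K V ↥M (fun m => x (g * (m : G))) ≫ f)
    (h : StarPreInjective K V τ) : StarStarPreInjective K V τ := by
  rintro ⟨Ω, hΩ⟩
  let u₀ : ↥Ω → Pt K V := fun _ => Classical.arbitrary _
  obtain ⟨U, hU, hu₀, -⟩ := exists_isAffineOpen_mem_and_subset
    (x := ev K (ptPow K V ↥Ω u₀)) (U := ⊤) trivial
  refine h ⟨Ω, {v | ev K (ptPow K V ↥Ω v) ∉ U}, ?_, fun hH => ?_, fun p => ?_⟩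
  · exact U.isOpen.isClosed_compl.preimage continuous_induced_dom
  · exact (hH ▸ Set.mem_univ u₀ : u₀ ∈ {v | ev K (ptPow K V ↥Ω v) ∉ U}) hu₀
  · refine subset_antisymm ?_ (Set.image_mono fun c hc => ⟨Set.mem_univ _, hc.2⟩)
    obtain ⟨Λ, R, s, hR, hdim⟩ := hΩ p
    have hmem : ∀ u : ↥Ω → Pt K V, τ (glue Ω u p) ∈ cyl K V Λ R s :=
      fun u => hR ▸ ⟨_, glue_mem_cyl (Set.mem_univ u) p, rfl⟩
    have hlt : topologicalKrullDim
        (Set.range fun (u : ↥Ω → Pt K V) (l : ↥Λ) => τ (glue Ω u p) l) <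
        topologicalKrullDim (↥Ω → Pt K V) := by
      refine (topologicalKrullDim_mono ?_).trans_lt (hdim.trans_eq
        (Homeomorph.Set.univ (↥Ω → Pt K V)).isHomeomorph.topologicalKrullDim_eq)
      rintro _ ⟨u, rfl⟩
      exact (hmem u).1
    rintro _ ⟨x, hx, rfl⟩
    obtain ⟨v, hv, hvx⟩ :=
      (isReg_localMap hτ Ω Λ p).exists_notMem_of_krullDim_range_lt hlt hU fun ω => x ω
    refine ⟨glue Ω v p, glue_mem_cyl hv p, funext fun g => ?_⟩
    rw [eq_glue_of_mem_cyl hx]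
    by_cases hg : g ∈ Λ
    · exact congrFun hvx ⟨g, hg⟩
    · rw [(hmem _).2 g hg, (hmem _).2 g hg]

end GardenOfEden

/-- Theorem 7.2, the Garden of Eden theorem for algebraic cellular
automata. Let `G` be an amenable group, `X` an irreducible complete algebraic variety
over an algebraically closed field `K`, `A := X(K)`, and `τ : A^G → A^G` an algebraic
cellular automaton over `(G,X,K)`. Then surjectivity, `(*)`-pre-injectivity,
`(**)`-pre-injectivity, and maximality of the algebraic mean dimension of `τ(A^G)` for
some (equivalently, any) Følner net are all equivalent; moreover pre-injectivity
implies surjectivity. -/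
theorem gardenOfEden_equivalences
    (G : Type) [Group G] (hG : Amenable G)
    (K : Type) [Field K] [IsAlgClosed K]
    (V : Over (SpecK K)) (hft : LocallyOfFiniteType V.hom) (hqc : QuasiCompact V.hom)
    (hirr : IrreducibleSpace V.left) (hcomplete : IsProper V.hom)
    (τ : (G → Pt K V) → (G → Pt K V)) (hca : IsAlgCA K V τ) :
    ((Function.Surjective τ ↔ StarPreInjective K V τ) ∧
     (Function.Surjective τ ↔ StarStarPreInjective K V τ) ∧
     (Function.Surjective τ ↔
        ∃ 𝓕 : FolnerNet G, mdim K V 𝓕 (Set.range τ) = dimE (vdim K V)) ∧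
     (Function.Surjective τ ↔
        ∀ 𝓕 : FolnerNet G, mdim K V 𝓕 (Set.range τ) = dimE (vdim K V))) ∧
    (PreInjective K V τ → Function.Surjective τ) := by
  obtain ⟨M, f, hτ⟩ := hca
  obtain ⟨𝓕⟩ := hG
  have := irreducibleSpace_pt K V
  have hne : Nonempty (Pt K V) := this.toNonempty
  obtain ⟨d, hd⟩ : ∃ d : ℕ, topologicalKrullDim V.left = d := by
    have hlt := topologicalKrullDim_lt_top K V.hom
    have hbot : topologicalKrullDim V.left ≠ ⊥ :=
      Order.krullDim_ne_bot_iff.2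
        ⟨⟨Set.univ, IrreducibleSpace.isIrreducible_univ _, isClosed_univ⟩⟩
    obtain ⟨D, hD⟩ := WithBot.ne_bot_iff_exists.1 hbot
    rw [← hD] at hlt ⊢
    obtain ⟨d, rfl⟩ := ENat.ne_top_iff_exists.1 (WithBot.coe_lt_coe.1 hlt).ne
    exact ⟨d, rfl⟩
  have hab : (∃ 𝓕 : FolnerNet G, mdim K V 𝓕 (Set.range τ) = dimE (vdim K V)) →
      StarPreInjective K V τ := by
    rintro ⟨𝓕, h𝓕⟩ ⟨Ω, H, hH, hne, h⟩
    refine (mdim_range_lt 𝓕 hτ hd hH hne h).ne ?_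
    rw [h𝓕, vdim, hd]
  have hbc : StarPreInjective K V τ → StarStarPreInjective K V τ :=
    starStarPreInjective_of_starPreInjective hτ
  have hca : StarStarPreInjective K V τ → Function.Surjective τ :=
    surjective_of_starStarPreInjective 𝓕 hτ hd
  have had : Function.Surjective τ →
      ∀ 𝓕 : FolnerNet G, mdim K V 𝓕 (Set.range τ) = dimE (vdim K V) := fun h 𝓕 => by
    rw [vdim, hd]
    exact mdim_range_of_surjective 𝓕 hd h
  have hda : (∀ 𝓕 : FolnerNet G, mdim K V 𝓕 (Set.range τ) = dimE (vdim K V)) →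
      ∃ 𝓕 : FolnerNet G, mdim K V 𝓕 (Set.range τ) = dimE (vdim K V) := fun h => ⟨𝓕, h 𝓕⟩
  have hpre : PreInjective K V τ → StarPreInjective K V τ := starPreInjective_of_preInjective
  exact ⟨⟨⟨fun h => hab (hda (had h)), fun h => hca (hbc h)⟩,
    ⟨fun h => hbc (hab (hda (had h))), hca⟩,
    ⟨fun h => hda (had h), fun h => hca (hbc (hab h))⟩,
    ⟨had, fun h => hca (hbc (hab (hda h)))⟩⟩, fun h => hca (hbc (hpre h))⟩

end GOE
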